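/- arXiv:1109.5063 — 5 statements merged into one kernel-verified Lean document; each statement's English description precedes it below -/
import Mathlib

section
/- Let d ≥ 1 and let X = (ℝ^d, ‖·‖) be a normed space such that ‖x‖ ≤ ‖x‖_∞ ≤ D‖x‖ for all x ∈ ℝ^d, where ‖·‖_∞ is the maximum norm and 1 ≤ D < 3/2. Then X contains a maximal equilateral set with exactly d+1 elements; in particular m(X) ≤ d+1. -/
/-- `N` is a norm on `ℝ^d`. -/
structure IsNorm {d : ℕ} (N : (Fin d → ℝ) → ℝ) : Prop where
  eq_zero_iff : ∀ x, N x = 0 ↔ x = 0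
  smul : ∀ (c : ℝ) (x), N (c • x) = |c| * N x
  add_le : ∀ x y, N (x + y) ≤ N x + N y

/-- A set `A ⊆ ℝ^d` is `lam`-equilateral with respect to the norm `N` if `lam > 0` and
the `N`-distance between any two distinct points of `A` equals `lam`. -/
def NEquilateralWith {d : ℕ} (N : (Fin d → ℝ) → ℝ) (A : Set (Fin d → ℝ)) (lam : ℝ) : Prop :=
  0 < lam ∧ A.Pairwise fun x y => N (x - y) = lam

/-- A set is equilateral w.r.t. `N` if it is `lam`-equilateral for some `lam > 0`. -/
def NEquilateral {d : ℕ} (N : (Fin d → ℝ) → ℝ) (A : Set (Fin d → ℝ)) : Prop :=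
  ∃ lam : ℝ, NEquilateralWith N A lam

/-- An equilateral set w.r.t. `N` is maximal if it is not properly contained in any
set equilateral w.r.t. `N`. -/
def NMaximalEquilateral {d : ℕ} (N : (Fin d → ℝ) → ℝ) (A : Set (Fin d → ℝ)) : Prop :=
  NEquilateral N A ∧ ∀ B : Set (Fin d → ℝ), NEquilateral N B → A ⊆ B → B = A

open MeasureTheory Polynomial

theorem det_one_add_eq_sum {ι : Type*} [Fintype ι] (A : (ι → ℝ) →L[ℝ] (ι → ℝ))
    {v : Fin (Fintype.card ι + 1) → ℝ} (hv : Function.Injective v) :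
    (1 + A).det =
      ∑ j, (Lagrange.basis Finset.univ v j).eval 1 * (1 + v j • A).det := by
  classical
  let M : Matrix ι ι ℝ := LinearMap.toMatrix' (A : (ι → ℝ) →ₗ[ℝ] (ι → ℝ))
  let p : ℝ[X] := (((X : ℝ[X]) • M.map C + (1 : Matrix ι ι ℝ).map C).det)
  have heval (t : ℝ) : p.eval t = (1 + t • A).det := by
    have h1 : (1 + t • A).det = (1 + t • M).det := by
      rw [ContinuousLinearMap.det, ← LinearMap.det_toMatrix']
      congr 1
      simp [M, Module.End.one_eq_id]
    rw [h1]
    change Polynomial.evalRingHom t p = _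
    rw [RingHom.map_det]
    congr 1
    ext i j
    by_cases hij : i = j <;> simp [hij, add_comm, Matrix.map_apply, mul_comm t]
  have hdeg : p.degree < (Finset.univ : Finset (Fin (Fintype.card ι + 1))).card := by
    refine degree_le_natDegree.trans_lt ?_
    rw [Finset.card_univ, Fintype.card_fin]
    exact_mod_cast Nat.lt_succ_of_le (natDegree_det_X_add_C_le M 1)
  have h := congrArg (eval 1) (Lagrange.eq_interpolate hv.injOn hdeg)
  rw [Lagrange.interpolate_apply, heval, one_smul, eval_finsetSum] at h
  simp only [eval_mul, eval_C, heval] at h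
  rw [h]
  exact Finset.sum_congr rfl fun j _ => mul_comm _ _

theorem det_one_add_pos {ι : Type*} [Fintype ι] (A : (ι → ℝ) →L[ℝ] (ι → ℝ))
    (hA : ‖A‖ < 1) : 0 < (1 + A).det := by
  have hne (s : ℝ) (hs : s ∈ Set.Icc (0 : ℝ) 1) : (1 + s • A).det ≠ 0 := by
    have h1 : IsUnit (1 + s • A) := by
      have := isUnit_one_sub_of_norm_lt_one (x := -(s • A)) (by
        rw [norm_neg, norm_smul, Real.norm_of_nonneg hs.1]
        nlinarith [hs.2, norm_nonneg A])
      simpa using this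
    have h2 : IsUnit ((1 + s • A : (ι → ℝ) →L[ℝ] (ι → ℝ)) : (ι → ℝ) →ₗ[ℝ] (ι → ℝ)) :=
      h1.map (ContinuousLinearMap.toLinearMapRingHom (R₁ := ℝ) (M₁ := ι → ℝ))
    exact (h2.map LinearMap.det).ne_zero
  have hcont : Continuous fun s : ℝ => (1 + s • A).det :=
    ContinuousLinearMap.continuous_det.comp (by fun_prop)
  by_contra! hle
  have h01 : (0 : ℝ) ∈ Set.Icc ((1 + (1 : ℝ) • A).det) ((1 + (0 : ℝ) • A).det) := by
    constructor
    · simpa using hle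
    · simp [ContinuousLinearMap.det]
  obtain ⟨s, hs, hs0⟩ := intermediate_value_Icc' zero_le_one hcont.continuousOn h01
  exact hne s hs hs0

theorem bijective_id_add {E : Type*} [NormedAddCommGroup E] [CompleteSpace E] {h : E → E}
    {K : NNReal} (hK : K < 1) (hh : LipschitzWith K h) :
    Function.Bijective fun x => x + h x := by
  refine ⟨fun x y hxy => ?_, fun y => ?_⟩
  · have h1 : x - y = h y - h x := by
      rw [sub_eq_sub_iff_add_eq_add, add_comm (h y)]
      exact hxy
    have h2 := hh.dist_le_mul y x
    rw [dist_eq_norm, dist_comm, dist_eq_norm, ← h1] at h2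
    have h3 : (K : ℝ) < 1 := hK
    exact sub_eq_zero.1 (norm_eq_zero.1 (by nlinarith [norm_nonneg (x - y)]))
  · have hc : ContractingWith K fun x => y - h x :=
      ⟨hK, LipschitzWith.of_dist_le_mul fun a b => by
        rw [dist_sub_left]; exact hh.dist_le_mul a b⟩
    refine ⟨hc.fixedPoint, ?_⟩
    have := hc.fixedPoint_isFixedPt
    exact add_eq_of_eq_sub this.symm

theorem image_id_add_eq {E : Type*} [AddCommGroup E] {h : E → E} {B : Set E}
    (hbij : Function.Bijective fun x => x + h x) (hB : ∀ x ∉ B, h x = 0) :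
    (fun x => x + h x) '' B = B := by
  ext y
  constructor
  · rintro ⟨x, hx, rfl⟩
    by_contra hy
    have h1 : (fun x => x + h x) (x + h x) = (fun x => x + h x) x := by
      simp only [hB _ hy, add_zero]
    exact hy (show x + h x ∈ B by rwa [show x + h x = x from hbij.1 h1])
  · intro hy
    obtain ⟨x, hx⟩ := hbij.2 y
    refine ⟨x, ?_, hx⟩
    by_contra hxB
    simp only [hB x hxB, add_zero] at hx
    exact hxB (hx ▸ hy)

theorem lintegral_det_id_add {ι : Type*} [Fintype ι] {h : (ι → ℝ) → (ι → ℝ)} {K : NNReal}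
    (hK : K < 1) (hh : LipschitzWith K h) {B : Set (ι → ℝ)} (hBm : MeasurableSet B)
    (hB : ∀ x ∉ B, h x = 0) :
    ∫⁻ x in B, ENNReal.ofReal (1 + fderiv ℝ h x).det = volume B := by
  have hbij := bijective_id_add hK hh
  let S : Set (ι → ℝ) := {x | DifferentiableAt ℝ h x}
  have hSm : MeasurableSet S := measurableSet_of_differentiableAt ℝ h
  have hS0 : volume Sᶜ = 0 := hh.ae_differentiableAt (μ := volume)
  have hcov := lintegral_abs_det_fderiv_eq_addHaar_image volume (s := B ∩ S)
    (f := fun x => x + h x) (f' := fun x => 1 + fderiv ℝ h x) (hBm.inter hSm)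
    (fun x hx => ((hasFDerivAt_id x).add hx.2.hasFDerivAt).hasFDerivWithinAt) hbij.1.injOn
  have habs (x : ι → ℝ) : |(1 + fderiv ℝ h x).det| = (1 + fderiv ℝ h x).det :=
    abs_of_pos (det_one_add_pos _ ((norm_fderiv_le_of_lipschitz ℝ hh).trans_lt hK))
  simp only [habs] at hcov
  have hae : (B ∩ S : Set (ι → ℝ)) =ᵐ[volume] B := inter_ae_eq_left_of_ae_eq_univ (ae_eq_univ.2 hS0)
  rw [setLIntegral_congr hae] at hcov
  rw [hcov]
  have hnull : volume ((fun x => x + h x) '' (B ∩ Sᶜ)) = 0 := by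
    have hl : LipschitzWith (1 + K) fun x => x + h x := LipschitzWith.id.add hh
    have := hl.hausdorffMeasure_image_le (d := Fintype.card ι) (by positivity) (B ∩ Sᶜ)
    rw [hausdorffMeasure_pi_real, measure_mono_null Set.inter_subset_right hS0, mul_zero] at this
    exact le_antisymm this bot_le
  have himage : (fun x => x + h x) '' (B ∩ S) ∪ (fun x => x + h x) '' (B ∩ Sᶜ) = B := by
    rw [← Set.image_union, Set.inter_union_compl, image_id_add_eq hbij hB]
  refine le_antisymm (measure_mono (Set.subset_union_left.trans_eq himage)) ?_
  calc volume B = volume (_ ∪ _) := congrArg _ himage.symm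
    _ ≤ _ := measure_union_le _ _
    _ = _ := by rw [hnull, add_zero]

theorem integral_det_id_add {ι : Type*} [Fintype ι] {h : (ι → ℝ) → (ι → ℝ)} {K : NNReal}
    (hK : K < 1) (hh : LipschitzWith K h) {B : Set (ι → ℝ)} (hBm : MeasurableSet B)
    (hB : ∀ x ∉ B, h x = 0) (hfin : volume B ≠ ⊤) :
    IntegrableOn (fun x => (1 + fderiv ℝ h x).det) B ∧
      ∫ x in B, (1 + fderiv ℝ h x).det = volume.real B := by
  have hpos (x : ι → ℝ) : 0 ≤ (1 + fderiv ℝ h x).det :=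
    (det_one_add_pos _ ((norm_fderiv_le_of_lipschitz ℝ hh).trans_lt hK)).le
  have hl := lintegral_det_id_add hK hh hBm hB
  have hm : Measurable fun x => (1 + fderiv ℝ h x).det :=
    ContinuousLinearMap.continuous_det.measurable.comp ((measurable_fderiv ℝ h).const_add 1)
  constructor
  · refine ⟨hm.aestronglyMeasurable, ?_⟩
    rw [hasFiniteIntegral_iff_ofReal (Filter.Eventually.of_forall hpos), hl]
    exact hfin.lt_top
  · rw [integral_eq_lintegral_of_nonneg_ae (Filter.Eventually.of_forall hpos)
      hm.aestronglyMeasurable, hl, Measure.real]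

theorem integral_det_id_add_of_lipschitz {ι : Type*} [Fintype ι] {h : (ι → ℝ) → (ι → ℝ)}
    {K : NNReal} (hh : LipschitzWith K h) {B : Set (ι → ℝ)} (hBm : MeasurableSet B)
    (hB : ∀ x ∉ B, h x = 0) (hfin : volume B ≠ ⊤) :
    ∫ x in B, (1 + fderiv ℝ h x).det = volume.real B := by
  let n := Fintype.card ι
  let v : Fin (n + 1) → ℝ := fun j => (j + 1) / ((n + 2) * (K + 1))
  have hpos : (0 : ℝ) < (n + 2) * (K + 1) := by positivity
  have hv : Function.Injective v := fun i j hij => by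
    have h1 := (div_left_inj' hpos.ne').1 hij
    exact Fin.ext (by exact_mod_cast add_right_cancel h1)
  have hint (j : Fin (n + 1)) := integral_det_id_add (h := v j • h) (K := ‖v j‖₊ * K) (by
      rw [← NNReal.coe_lt_coe, NNReal.coe_mul, coe_nnnorm, NNReal.coe_one,
        Real.norm_of_nonneg (by positivity), div_mul_eq_mul_div, div_lt_one hpos]
      have : (j : ℝ) + 1 < n + 2 := by exact_mod_cast (by omega : (j : ℕ) + 1 < n + 2)
      nlinarith [K.coe_nonneg])
    ((lipschitzWith_smul (v j)).comp hh) hBm (fun x hx => by simp [hB x hx]) hfin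
  simp only [fderiv_const_smul_field, Pi.smul_apply] at hint
  calc ∫ x in B, (1 + fderiv ℝ h x).det
      = ∫ x in B, ∑ j, (Lagrange.basis Finset.univ v j).eval 1 *
          (1 + v j • fderiv ℝ h x).det := by
        congr 1 with x
        exact det_one_add_eq_sum _ hv
    _ = ∑ j, (Lagrange.basis Finset.univ v j).eval 1 * volume.real B := by
        rw [integral_finsetSum _ fun j _ => (hint j).1.const_mul _]
        simp_rw [integral_const_mul, (hint _).2]
    _ = volume.real B := by
        rw [← Finset.sum_mul, ← eval_finsetSum, Lagrange.sum_basis hv.injOn Finset.univ_nonempty,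
          eval_one, one_mul]

/-- The coordinatewise projection of `ι → ℝ` onto the box `[a, b]^ι`. -/
def boxClamp {ι : Type*} (a b : ℝ) (x : ι → ℝ) : ι → ℝ := fun i => max a (min b (x i))

theorem boxClamp_mem {ι : Type*} {a b : ℝ} (hab : a ≤ b) (x : ι → ℝ) (i : ι) :
    a ≤ boxClamp a b x i ∧ boxClamp a b x i ≤ b :=
  ⟨le_max_left _ _, max_le hab (min_le_left _ _)⟩

theorem boxClamp_apply_of_mem {ι : Type*} {a b : ℝ} {x : ι → ℝ} {i : ι}
    (ha : a ≤ x i) (hb : x i ≤ b) : boxClamp a b x i = x i := by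
  rw [boxClamp, min_eq_right hb, max_eq_right ha]

theorem abs_boxClamp_sub_le {ι : Type*} (a b : ℝ) (x y : ι → ℝ) (i : ι) :
    |boxClamp a b x i - boxClamp a b y i| ≤ |x i - y i| := by
  simp only [boxClamp]
  grind

theorem lipschitzWith_boxClamp {ι : Type*} [Fintype ι] (a b : ℝ) :
    LipschitzWith 1 (boxClamp a b : (ι → ℝ) → (ι → ℝ)) :=
  LipschitzWith.of_dist_le_mul fun x y => by
    rw [NNReal.coe_one, one_mul]
    exact (dist_pi_le_iff dist_nonneg).2 fun i =>
      (abs_boxClamp_sub_le a b x y i).trans (dist_le_pi_dist x y i)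

theorem LipschitzWith.smul_of_bounded {α E : Type*} [PseudoMetricSpace α]
    [SeminormedAddCommGroup E] [NormedSpace ℝ E] {s : α → ℝ} {w : α → E} {Ks Kw Cs Cw : NNReal}
    (hs : LipschitzWith Ks s) (hw : LipschitzWith Kw w) (hsC : ∀ x, |s x| ≤ Cs)
    (hwC : ∀ x, ‖w x‖ ≤ Cw) : LipschitzWith (Cs * Kw + Ks * Cw) fun x => s x • w x :=
  LipschitzWith.of_dist_le_mul fun x y => by
    have h1 : s x • w x - s y • w y = s x • (w x - w y) + (s x - s y) • w y := by module
    have h2 := hs.dist_le_mul x y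
    have h3 := hw.dist_le_mul x y
    rw [dist_eq_norm] at h2 h3 ⊢
    rw [h1]
    calc ‖s x • (w x - w y) + (s x - s y) • w y‖
        ≤ |s x| * ‖w x - w y‖ + ‖s x - s y‖ * ‖w y‖ := by
          refine (norm_add_le _ _).trans ?_
          rw [norm_smul, norm_smul, Real.norm_eq_abs (s x)]
      _ ≤ Cs * (Kw * dist x y) + Ks * dist x y * Cw := by
          gcongr
          exacts [hsC x, hwC y]
      _ = ↑(Cs * Kw + Ks * Cw) * dist x y := by push_cast; ring

theorem det_eq_zero_of_abs_apply_le {ι : Type*} [Fintype ι] {f : (ι → ℝ) → (ι → ℝ)}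
    {f' : (ι → ℝ) →L[ℝ] (ι → ℝ)} {x : ι → ℝ} {R : ℝ} {k : ι} (hf : HasFDerivAt f f' x)
    (hle : ∀ᶠ y in nhds x, |f y k| ≤ R) (hx : |f x k| = R) : f'.det = 0 := by
  have hk : HasFDerivAt (fun y => f y k) ((ContinuousLinearMap.proj k).comp f') x :=
    hasFDerivAt_pi'.1 hf k
  have h0 : (ContinuousLinearMap.proj k).comp f' = 0 := by
    rcases le_total 0 (f x k) with h | h
    · rw [abs_of_nonneg h] at hx
      exact IsLocalMax.hasFDerivAt_eq_zero (hle.mono fun y hy => hx ▸ (le_abs_self _).trans hy) hk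
    · rw [abs_of_nonpos h] at hx
      refine IsLocalMin.hasFDerivAt_eq_zero (hle.mono fun y hy => ?_) hk
      linarith [neg_abs_le (f y k)]
  by_contra hdet
  classical
  obtain ⟨v, hv⟩ := (LinearMap.equivOfDetNeZero (f' : (ι → ℝ) →ₗ[ℝ] (ι → ℝ)) hdet).surjective
    (Pi.single k 1)
  have h1 : f' v = Pi.single k 1 := hv
  have h2 := DFunLike.congr_fun h0 v
  simp [h1] at h2

/-- Brouwer's fixed point theorem for Lipschitz maps into the unit cube. -/
theorem exists_fixedPoint_of_lipschitz {ι : Type*} [Fintype ι] {φ : (ι → ℝ) → (ι → ℝ)}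
    {K : NNReal} (hφ : LipschitzWith K φ) (hb : ∀ x, ‖φ x‖ ≤ 1) : ∃ x, φ x = x := by
  by_contra! hne
  obtain ⟨δ, hδ, hδle⟩ : ∃ δ > 0, ∀ x : ι → ℝ, ‖x‖ ≤ 2 → δ ≤ ‖x - φ x‖ := by
    obtain ⟨z, -, hz⟩ := (isCompact_closedBall (0 : ι → ℝ) 2).exists_isMinOn
      ⟨0, by simp⟩ (f := fun x => ‖x - φ x‖)
      (continuous_id.sub hφ.continuous).norm.continuousOn
    exact ⟨‖z - φ z‖, norm_pos_iff.2 (sub_ne_zero.2 (hne z).symm),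
      fun x hx => hz (by simpa using hx)⟩
  let c : (ι → ℝ) → (ι → ℝ) := boxClamp (-3) 3
  let L : ℝ := 5 / δ + 1
  have hL : 1 ≤ L := le_add_of_nonneg_left (by positivity)
  have hLδ : 5 ≤ L * δ := by
    have : L * δ = 5 + δ := by simp only [L]; field_simp
    linarith
  let s : (ι → ℝ) → ℝ := fun x => max 0 (3 - ‖x‖)
  let w : (ι → ℝ) → (ι → ℝ) := fun x => c x - φ x
  let y : (ι → ℝ) → (ι → ℝ) := fun x => x + L • s x • w x
  let h : (ι → ℝ) → (ι → ℝ) := fun x => c (y x) - c x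
  have hc : LipschitzWith 1 c := lipschitzWith_boxClamp _ _
  have hcb (x : ι → ℝ) : ‖c x‖ ≤ 3 := (pi_norm_le_iff_of_nonneg (by norm_num)).2 fun i =>
    abs_le.2 (boxClamp_mem (by norm_num) x i)
  have hcx {x : ι → ℝ} (hx : ‖x‖ < 3) : c x = x := funext fun i => by
    have := abs_le.1 ((norm_le_pi_norm x i).trans hx.le)
    exact boxClamp_apply_of_mem this.1 this.2
  have hs : LipschitzWith 1 s := by
    simpa using ((LipschitzWith.const (3 : ℝ)).sub (lipschitzWith_one_norm (E := ι → ℝ))).const_max 0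
  have hw : LipschitzWith (1 + K) w := hc.sub hφ
  have hsw := hs.smul_of_bounded hw (Cs := 3) (Cw := 4)
    (fun x => by
      rw [abs_of_nonneg (le_max_left _ _)]
      exact max_le (by simp) (by simp))
    (fun x => (norm_sub_le _ _).trans (by
      have := add_le_add (hcb x) (hb x)
      push_cast
      linarith))
  have hy := LipschitzWith.id.add ((lipschitzWith_smul L).comp hsw)
  have hh := (hc.comp hy).sub hc
  have hfar (x : ι → ℝ) (hx : ‖x‖ < 3) : ∃ k, 3 ≤ |y x k| := by
    have hsx : s x = 3 - ‖x‖ := max_eq_right (by linarith)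
    have hyk (k : ι) : y x k = x k + L * ((3 - ‖x‖) * (x k - φ x k)) := by
      simp [y, w, hsx, hcx hx]
    rcases le_or_gt ‖x‖ 2 with h2 | h2
    · obtain ⟨k, hk⟩ : ∃ k, δ ≤ |x k - φ x k| := by
        by_contra! hlt
        exact (hδle x h2).not_gt ((pi_norm_lt_iff hδ).2 hlt)
      have hxk : |x k| ≤ 2 := (norm_le_pi_norm x k).trans h2
      refine ⟨k, ?_⟩
      have h3 : 5 ≤ |L * ((3 - ‖x‖) * (x k - φ x k))| := by
        rw [abs_mul, abs_mul, abs_of_nonneg (by linarith : 0 ≤ L),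
          abs_of_nonneg (by linarith : 0 ≤ 3 - ‖x‖)]
        calc (5 : ℝ) ≤ L * (1 * δ) := by linarith
          _ ≤ _ := by gcongr; linarith
      rw [hyk]
      have h4 := abs_sub_abs_le_abs_sub (L * ((3 - ‖x‖) * (x k - φ x k))) (-x k)
      rw [abs_neg, sub_neg_eq_add, add_comm _ (x k)] at h4
      linarith
    · obtain ⟨k, hk⟩ : ∃ k, ‖x‖ ≤ |x k| := by
        by_contra! hlt
        exact lt_irrefl _ ((pi_norm_lt_iff (by linarith)).2 hlt)
      have hφk := abs_le.1 ((norm_le_pi_norm (φ x) k).trans (hb x))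
      refine ⟨k, ?_⟩
      rw [hyk]
      have h5 : 3 - ‖x‖ ≤ L * (3 - ‖x‖) := le_mul_of_one_le_left (by linarith) hL
      rw [← mul_assoc]
      rcases le_total 0 (x k) with h0 | h0
      · rw [abs_of_nonneg h0] at hk
        refine le_trans ?_ (le_abs_self _)
        nlinarith
      · rw [abs_of_nonpos h0] at hk
        refine le_trans ?_ (neg_le_abs _)
        nlinarith
  have hout (x : ι → ℝ) (hx : x ∉ Metric.ball (0 : ι → ℝ) 3) : h x = 0 := by
    have : s x = 0 := max_eq_left (by simpa using hx)
    simp [h, y, this]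
  have hint := integral_det_id_add_of_lipschitz (h := h) hh measurableSet_ball hout
    measure_ball_lt_top.ne
  have hzero : ∀ᵐ x, x ∈ Metric.ball (0 : ι → ℝ) 3 → (1 + fderiv ℝ h x).det = 0 := by
    filter_upwards [hh.ae_differentiableAt (μ := volume)] with x hd hx
    obtain ⟨k, hk⟩ := hfar x (by simpa using hx)
    have heq (z : ι → ℝ) (hz : z ∈ Metric.ball (0 : ι → ℝ) 3) : z + h z = c (y z) := by
      simp only [h, hcx (mem_ball_zero_iff.1 hz), add_sub_cancel]
    refine det_eq_zero_of_abs_apply_le (f := fun z => z + h z) (k := k) (R := 3)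
      ((hasFDerivAt_id x).add hd.hasFDerivAt) ?_ ?_
    · filter_upwards [Metric.isOpen_ball.mem_nhds hx] with z hz
      rw [heq z hz]
      exact (norm_le_pi_norm _ k).trans (hcb _)
    · simp only [heq x hx, c, boxClamp]
      grind
  rw [setIntegral_congr_ae measurableSet_ball (g := fun _ => 0) hzero, integral_zero] at hint
  exact (ENNReal.toReal_pos (Metric.measure_ball_pos _ _ (by norm_num)).ne'
    measure_ball_lt_top.ne).ne hint

theorem IsNorm.sub_comm {d : ℕ} {N : (Fin d → ℝ) → ℝ} (hN : IsNorm N) (x y : Fin d → ℝ) :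
    N (x - y) = N (y - x) := by
  have := hN.smul (-1) (y - x)
  simpa using this

theorem IsNorm.abs_sub_le {d : ℕ} {N : (Fin d → ℝ) → ℝ} (hN : IsNorm N) (x y : Fin d → ℝ) :
    |N x - N y| ≤ N (x - y) := by
  have h1 := hN.add_le (x - y) y
  have h2 := hN.add_le (y - x) x
  rw [sub_add_cancel] at h1 h2
  rw [hN.sub_comm y x] at h2
  exact abs_sub_le_iff.2 ⟨by linarith, by linarith⟩

/-- The family of `d + 1` points whose `j`-th member has coordinates `ε (m, j)` for `m < j`, then
`-1` for `m = j`, and `-1/2` for `m > j`. -/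
noncomputable def simplexPoint {d : ℕ} (ε : Fin d × Fin (d + 1) → ℝ) (j : Fin (d + 1)) :
    Fin d → ℝ :=
  fun m => if j < m.castSucc then -1 / 2 else if j = m.castSucc then -1 else ε (m, j)

section simplexPoint

variable {d : ℕ} {ε ε' : Fin d × Fin (d + 1) → ℝ} {j : Fin (d + 1)} {m : Fin d}

theorem simplexPoint_of_lt (h : j < m.castSucc) : simplexPoint ε j m = -1 / 2 := if_pos h

theorem simplexPoint_castSucc_self : simplexPoint ε m.castSucc m = -1 := by
  simp [simplexPoint]

theorem simplexPoint_of_gt (h : m.castSucc < j) : simplexPoint ε j m = ε (m, j) := by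
  simp [simplexPoint, h.not_gt, h.ne']

theorem norm_simplexPoint_sub_le (ε ε' : Fin d × Fin (d + 1) → ℝ) (j : Fin (d + 1)) :
    ‖simplexPoint ε j - simplexPoint ε' j‖ ≤ ‖ε - ε'‖ := by
  refine (pi_norm_le_iff_of_nonneg (norm_nonneg _)).2 fun m => ?_
  rcases lt_trichotomy j m.castSucc with h | rfl | h
  · simp [simplexPoint_of_lt h]
  · simp [simplexPoint_castSucc_self]
  · rw [Pi.sub_apply, simplexPoint_of_gt h, simplexPoint_of_gt h]
    exact norm_le_pi_norm (ε - ε') (m, j)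

theorem norm_simplexPoint_sub {i : Fin d} (hε : ∀ k, 0 ≤ ε k ∧ ε k ≤ 1 / 2)
    (hij : i.castSucc < j) :
    ‖simplexPoint ε i.castSucc - simplexPoint ε j‖ = 1 + ε (i, j) := by
  have h0 := hε (i, j)
  refine le_antisymm ((pi_norm_le_iff_of_nonneg (by linarith)).2 fun m => ?_) ?_
  · rw [Pi.sub_apply, Real.norm_eq_abs, abs_le]
    rcases lt_trichotomy m i with h | rfl | h
    · have h' : m.castSucc < i.castSucc := h
      rw [simplexPoint_of_gt h', simplexPoint_of_gt (h'.trans hij)]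
      have h1 := hε (m, i.castSucc)
      have h2 := hε (m, j)
      constructor <;> linarith
    · rw [simplexPoint_castSucc_self, simplexPoint_of_gt hij]
      constructor <;> linarith
    · have h' : i.castSucc < m.castSucc := h
      rw [simplexPoint_of_lt h']
      rcases lt_trichotomy j m.castSucc with hj | rfl | hj
      · rw [simplexPoint_of_lt hj]
        constructor <;> linarith
      · rw [simplexPoint_castSucc_self]
        constructor <;> linarith
      · rw [simplexPoint_of_gt hj]
        have h2 := hε (m, j)
        constructor <;> linarith
  · have h1 := norm_le_pi_norm (simplexPoint ε i.castSucc - simplexPoint ε j) i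
    rw [Pi.sub_apply, simplexPoint_castSucc_self, simplexPoint_of_gt hij, Real.norm_eq_abs] at h1
    linarith [neg_le_abs (-1 - ε (i, j))]

theorem exists_norm_sub_simplexPoint_lt (hε : ∀ k, 0 ≤ ε k ∧ ε k ≤ 1 / 2) {q : Fin d → ℝ}
    (hq : ∀ j, ‖q - simplexPoint ε j‖ < 3 / 2) : ∃ j, ‖q - simplexPoint ε j‖ < 1 := by
  by_contra! hfar
  have hcoord (j : Fin (d + 1)) (m : Fin d) : |q m - simplexPoint ε j m| < 3 / 2 :=
    (norm_le_pi_norm (q - simplexPoint ε j) m).trans_lt (hq j)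
  have hlt (m : Fin d) : q m < 1 / 2 := by
    have := (abs_lt.1 (hcoord m.castSucc m)).2
    rw [simplexPoint_castSucc_self] at this
    linarith
  have hgt (m : Fin d) : -(3 / 2) < q m := by
    have := (abs_lt.1 (hcoord (Fin.last d) m)).1
    rw [simplexPoint_of_gt (Fin.castSucc_lt_last m)] at this
    linarith [(hε (m, Fin.last d)).1]
  have hnonneg (i : Fin d) : 0 ≤ q i := by
    induction i using WellFoundedLT.induction with
    | ind i ih =>
      by_contra! hi
      refine (hfar i.castSucc).not_gt ((pi_norm_lt_iff one_pos).2 fun m => ?_)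
      rw [Pi.sub_apply, Real.norm_eq_abs, abs_lt]
      have h1 := hlt m
      have h2 := hgt m
      rcases lt_trichotomy m i with h | rfl | h
      · rw [simplexPoint_of_gt (show m.castSucc < i.castSucc from h)]
        have h3 := hε (m, i.castSucc)
        have h4 := ih m h
        constructor <;> linarith
      · rw [simplexPoint_castSucc_self]
        constructor <;> linarith
      · rw [simplexPoint_of_lt (show i.castSucc < m.castSucc from h)]
        constructor <;> linarith
  refine (hfar (Fin.last d)).not_gt ((pi_norm_lt_iff one_pos).2 fun m => ?_)
  rw [Pi.sub_apply, simplexPoint_of_gt (Fin.castSucc_lt_last m), Real.norm_eq_abs, abs_lt]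
  have h1 := hε (m, Fin.last d)
  have h2 := hlt m
  have h3 := hnonneg m
  constructor <;> linarith

end simplexPoint

theorem exists_simplexPoint_pairwise_eq_one {d : ℕ} {N : (Fin d → ℝ) → ℝ} (hN : IsNorm N)
    {D : ℝ} (hD1 : 1 ≤ D) (hD2 : D < 3 / 2)
    (hbound : ∀ x : Fin d → ℝ, N x ≤ ‖x‖ ∧ ‖x‖ ≤ D * N x) :
    ∃ ε : Fin d × Fin (d + 1) → ℝ, (∀ k, 0 ≤ ε k ∧ ε k ≤ 1 / 2) ∧
      Pairwise fun i j => N (simplexPoint ε i - simplexPoint ε j) = 1 := by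
  let c : (Fin d × Fin (d + 1) → ℝ) → (Fin d × Fin (d + 1) → ℝ) := boxClamp 0 (1 / 2)
  let φ : (Fin d × Fin (d + 1) → ℝ) → (Fin d × Fin (d + 1) → ℝ) := fun x k =>
    if k.1.castSucc < k.2 then
      1 + c x k - N (simplexPoint (c x) k.1.castSucc - simplexPoint (c x) k.2)
    else 0
  have hc (x) (k) : 0 ≤ c x k ∧ c x k ≤ 1 / 2 := boxClamp_mem (by norm_num) x k
  have hφ_mem (x) (k) : 0 ≤ φ x k ∧ φ x k ≤ 1 / 2 := by
    by_cases hk : k.1.castSucc < k.2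
    · simp only [φ, if_pos hk]
      obtain ⟨h1, h2⟩ := hbound (simplexPoint (c x) k.1.castSucc - simplexPoint (c x) k.2)
      rw [norm_simplexPoint_sub (hc x) hk] at h1 h2
      have h3 := hc x k
      constructor
      · linarith
      · nlinarith
    · simp [φ, if_neg hk]
  have hφ_lip : LipschitzWith 3 φ := LipschitzWith.of_dist_le_mul fun x y => by
    have hcxy : ‖c x - c y‖ ≤ ‖x - y‖ := by
      have := (lipschitzWith_boxClamp 0 (1 / 2)).dist_le_mul x y
      rwa [NNReal.coe_one, one_mul, dist_eq_norm, dist_eq_norm] at this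
    rw [dist_eq_norm, dist_eq_norm]
    refine (pi_norm_le_iff_of_nonneg (by positivity)).2 fun k => ?_
    rw [Pi.sub_apply, Real.norm_eq_abs]
    by_cases hk : k.1.castSucc < k.2
    · simp only [φ, if_pos hk]
      set u := simplexPoint (c x)
      set v := simplexPoint (c y)
      have h1 := (hN.abs_sub_le (u k.1.castSucc - u k.2) (v k.1.castSucc - v k.2)).trans
        (hbound _).1
      rw [sub_sub_sub_comm] at h1
      have h2 := norm_sub_le (u k.1.castSucc - v k.1.castSucc) (u k.2 - v k.2)
      have h3 := norm_simplexPoint_sub_le (c x) (c y) k.1.castSucc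
      have h4 := norm_simplexPoint_sub_le (c x) (c y) k.2
      have h5 : |c x k - c y k| ≤ ‖c x - c y‖ := norm_le_pi_norm (c x - c y) k
      rw [abs_le] at h1 h5 ⊢
      push_cast
      constructor <;> linarith [h1.1, h1.2, h5.1, h5.2]
    · simp only [φ, if_neg hk, sub_self, abs_zero]
      positivity
  obtain ⟨x, hx⟩ := exists_fixedPoint_of_lipschitz hφ_lip fun x =>
    (pi_norm_le_iff_of_nonneg zero_le_one).2 fun k => by
      have := hφ_mem x k
      rw [Real.norm_of_nonneg this.1]
      linarith
  have hx_mem (k) : 0 ≤ x k ∧ x k ≤ 1 / 2 := hx ▸ hφ_mem x k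
  have hcx : c x = x := funext fun k => boxClamp_apply_of_mem (hx_mem k).1 (hx_mem k).2
  have hlt (i j : Fin (d + 1)) (hij : i < j) : N (simplexPoint x i - simplexPoint x j) = 1 := by
    obtain ⟨i, rfl⟩ := Fin.exists_castSucc_eq.2 (Fin.ne_last_of_lt hij)
    have h1 := congrFun hx (i, j)
    simp only [φ, if_pos hij, hcx] at h1
    linarith
  refine ⟨x, hx_mem, fun i j hij => ?_⟩
  rcases lt_or_gt_of_ne hij with h | h
  · exact hlt i j h
  · exact (hN.sub_comm _ _).trans (hlt j i h)

/-- Let `d ≥ 1` and let `X = (ℝ^d, N)` be a normed space such that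
`N x ≤ ‖x‖_∞ ≤ D · N x` for all `x`, where `1 ≤ D < 3/2` and `‖·‖_∞` is the maximum norm
(the standard norm on `Fin d → ℝ`). Then `X` contains a maximal equilateral set with
exactly `d + 1` elements; in particular `m(X) ≤ d + 1`. -/
theorem statement0 (d : ℕ) (hd : 1 ≤ d) (N : (Fin d → ℝ) → ℝ) (hN : IsNorm N)
    (D : ℝ) (hD1 : 1 ≤ D) (hD2 : D < 3 / 2)
    (hbound : ∀ x : Fin d → ℝ, N x ≤ ‖x‖ ∧ ‖x‖ ≤ D * N x) :
    ∃ A : Set (Fin d → ℝ), NMaximalEquilateral N A ∧ A.Finite ∧ A.ncard = d + 1 := by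
  obtain ⟨ε, hε, hone⟩ := exists_simplexPoint_pairwise_eq_one hN hD1 hD2 hbound
  have hinj : Function.Injective (simplexPoint ε) := fun i j hij => by
    by_contra hne
    have h : N (simplexPoint ε i - simplexPoint ε j) = 1 := hone hne
    rw [hij, sub_self, (hN.eq_zero_iff 0).2 rfl] at h
    exact zero_ne_one h
  refine ⟨Set.range (simplexPoint ε), ⟨⟨1, one_pos, ?_⟩, ?_⟩, Set.finite_range _, ?_⟩
  · rintro _ ⟨i, rfl⟩ _ ⟨j, rfl⟩ hij
    exact hone (ne_of_apply_ne _ hij)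
  · rintro B ⟨lam, -, hB⟩ hsub
    refine Set.Subset.antisymm (fun q hq => ?_) hsub
    by_contra hqA
    have hmem (j : Fin (d + 1)) : simplexPoint ε j ∈ B := hsub (Set.mem_range_self j)
    have h0 : (0 : Fin (d + 1)) ≠ Fin.last d := by
      simp [Fin.ext_iff]
      omega
    have hlam : lam = 1 := (hB (hmem _) (hmem _) (hinj.ne h0)).symm.trans (hone h0)
    have hdist (j : Fin (d + 1)) : N (q - simplexPoint ε j) = 1 :=
      hlam ▸ hB hq (hmem j) fun h => hqA ⟨j, h.symm⟩
    obtain ⟨j, hj⟩ := exists_norm_sub_simplexPoint_lt hε (q := q) fun j => by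
      have := (hbound (q - simplexPoint ε j)).2
      rw [hdist j] at this
      linarith
    linarith [(hbound (q - simplexPoint ε j)).1, hdist j]
  · rw [← Set.image_univ, Set.ncard_image_of_injective _ hinj, Set.ncard_univ, Nat.card_fin]
end

section
/- For every real p ≥ 1 and every integer d ≥ 1, the space ℓ_p^d contains a maximal equilateral set of cardinality at most d+1; that is, m(ℓ_p^d) ≤ d+1. -/
/-- A set `A` in a normed space is `lam`-equilateral if `lam > 0` and the distance
between any two distinct points of `A` equals `lam`. -/
def EquilateralWith {E : Type*} [NormedAddCommGroup E] (A : Set E) (lam : ℝ) : Prop :=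
  0 < lam ∧ A.Pairwise fun x y => ‖x - y‖ = lam

/-- A set is equilateral if it is `lam`-equilateral for some `lam > 0`. -/
def Equilateral {E : Type*} [NormedAddCommGroup E] (A : Set E) : Prop :=
  ∃ lam : ℝ, EquilateralWith A lam

/-- An equilateral set is maximal if it is not properly contained in any equilateral set. -/
def MaximalEquilateral {E : Type*} [NormedAddCommGroup E] (A : Set E) : Prop :=
  Equilateral A ∧ ∀ B : Set E, Equilateral B → A ⊆ B → B = A

open Finset in
/-- A finite set of points whose pairwise distances have `p`-th power `2`, and such that no point
is at this distance from all of them, is a maximal equilateral set of `ℓ_p^d`. -/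
lemma exists_maximalEquilateral_of_finset {p : ℝ} (hp : 1 ≤ p) {d : ℕ}
    (A : Finset (Fin d → ℝ)) (hcard : #A ≤ d + 1) (htwo : ∃ a ∈ A, ∃ b ∈ A, a ≠ b)
    (hdist : ∀ a ∈ A, ∀ b ∈ A, a ≠ b → ∑ i, |a i - b i| ^ p = 2)
    (hmax : ∀ x : Fin d → ℝ, ¬ ∀ a ∈ A, ∑ i, |x i - a i| ^ p = 2) :
    letI : Fact (1 ≤ ENNReal.ofReal p) := ⟨ENNReal.one_le_ofReal.mpr hp⟩
    ∃ A : Set (PiLp (ENNReal.ofReal p) fun _ : Fin d => ℝ),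
      MaximalEquilateral A ∧ A.Finite ∧ A.ncard ≤ d + 1 := by
  let _ : Fact (1 ≤ ENNReal.ofReal p) := ⟨ENNReal.one_le_ofReal.mpr hp⟩
  have hp0 : 0 < p := by linarith
  have hreal : (ENNReal.ofReal p).toReal = p := ENNReal.toReal_ofReal hp0.le
  have hnorm (x y : PiLp (ENNReal.ofReal p) fun _ : Fin d => ℝ) :
      ‖x - y‖ = (∑ i, |x i - y i| ^ p) ^ (1 / p) := by
    rw [PiLp.norm_eq_sum (by rw [hreal]; exact hp0), hreal]
    simp
  have hiff (x y : PiLp (ENNReal.ofReal p) fun _ : Fin d => ℝ) :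
      ‖x - y‖ = (2 : ℝ) ^ (1 / p) ↔ ∑ i, |x i - y i| ^ p = 2 := by
    rw [hnorm]
    exact Real.rpow_left_inj (sum_nonneg fun i _ => by positivity) (by norm_num) (by positivity)
  refine ⟨WithLp.toLp _ '' (A : Set (Fin d → ℝ)), ⟨⟨2 ^ (1 / p), by positivity, ?_⟩, ?_⟩,
    A.finite_toSet.image _, ?_⟩
  · rintro _ ⟨a, ha, rfl⟩ _ ⟨b, hb, rfl⟩ hab
    exact (hiff _ _).2 (hdist a ha b hb fun h => hab (by rw [h]))
  · rintro B ⟨lam, -, hB⟩ hAB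
    obtain ⟨a, ha, b, hb, hab⟩ := htwo
    have hlam : lam = 2 ^ (1 / p) := by
      rw [← (hiff (WithLp.toLp _ a) (WithLp.toLp _ b)).2 (hdist a ha b hb hab)]
      exact (hB (hAB ⟨a, ha, rfl⟩) (hAB ⟨b, hb, rfl⟩)
        fun h => hab (WithLp.toLp_injective _ h)).symm
    refine Set.Subset.antisymm (fun x hx => ?_) hAB
    by_contra hxA
    refine hmax (WithLp.ofLp x) fun c hc => ?_
    have := hB hx (hAB ⟨c, hc, rfl⟩) fun h => hxA ⟨c, hc, h.symm⟩
    exact (hiff x (WithLp.toLp _ c)).1 (this.trans hlam)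
  · refine (Set.ncard_image_le A.finite_toSet).trans ?_
    rwa [Set.ncard_coe_finset]

/-- Clarkson's inequality for exponents between `1` and `2`, normalised. -/
lemma one_add_rpow_add_one_sub_rpow_le {p s : ℝ} (hp0 : 0 < p) (hp2 : p ≤ 2) (hs0 : 0 ≤ s)
    (hs1 : s ≤ 1) : (1 + s) ^ p + (1 - s) ^ p ≤ 2 + 2 * s ^ p := by
  have hsq (x : ℝ) (hx : 0 ≤ x) : (x ^ 2) ^ (p / 2) = x ^ p := by
    rw [← Real.rpow_natCast, ← Real.rpow_mul hx]
    congr 1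
    push_cast
    ring
  have hconc := (Real.concaveOn_rpow (p := p / 2) (by linarith) (by linarith)).2
    (Set.mem_Ici.2 (sq_nonneg (1 + s))) (Set.mem_Ici.2 (sq_nonneg (1 - s)))
    (show (0 : ℝ) ≤ 1 / 2 by norm_num) (show (0 : ℝ) ≤ 1 / 2 by norm_num) (by norm_num)
  simp only [smul_eq_mul] at hconc
  rw [hsq _ (by linarith), hsq _ (by linarith),
    show 1 / 2 * (1 + s) ^ 2 + 1 / 2 * (1 - s) ^ 2 = 1 + s ^ 2 by ring] at hconc
  have hsub := Real.rpow_add_le_add_rpow (p := p / 2) (a := 1) (b := s ^ 2) (by norm_num)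
    (by positivity) (by linarith) (by linarith)
  rw [hsq s hs0, Real.one_rpow] at hsub
  linarith

lemma two_lt_mul_add_rpow {p N s t : ℝ} (hp : 1 < p) (hN : 1 ≤ N) (hs : 0 < s) (ht : 0 < t)
    (hgs : (1 + s) ^ p + (N - 1) * s ^ p = 2) (hgt : |1 - t| ^ p + (N - 1) * t ^ p = 2) :
    2 < N * (t + s) ^ p := by
  have hp0 : 0 < p := by linarith
  rcases lt_or_ge (1 / 2) t with hhalf | hhalf
  · have h1 : |1 - t| ^ p < t ^ p :=
      Real.rpow_lt_rpow (abs_nonneg _) (abs_lt.2 ⟨by linarith, by linarith⟩) hp0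
    have h2 : t ^ p ≤ (t + s) ^ p := Real.rpow_le_rpow ht.le (by linarith) hp0.le
    nlinarith
  rw [abs_of_nonneg (by linarith)] at hgt
  have htp : 0 < t ^ p := by positivity
  have hsp : 0 < s ^ p := by positivity
  have h1t : (1 - t) ^ p < 1 := Real.rpow_lt_one (by linarith) (by linarith) hp0
  rcases le_total p 2 with hp2 | hp2
  · have h1s : 1 + s ^ p ≤ (1 + s) ^ p := by
      simpa using Real.add_rpow_le_rpow_add (a := 1) (b := s) (by norm_num) hs.le hp.le
    have hst : s < t := by
      refine (Real.rpow_lt_rpow_iff hs.le ht.le hp0).1 ?_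
      by_contra! h
      nlinarith
    have h1 : (1 - t) ^ p < (1 - s) ^ p :=
      Real.rpow_lt_rpow (by linarith) (by linarith) hp0
    have h2 := one_add_rpow_add_one_sub_rpow_le hp0 hp2 hs.le (by linarith)
    have h3 : s ^ p < t ^ p := Real.rpow_lt_rpow hs.le hst hp0
    have h4 : t ^ p + s ^ p ≤ (t + s) ^ p := Real.add_rpow_le_rpow_add ht.le hs.le hp.le
    nlinarith
  · by_contra! hle
    set r : ℝ := 2 ^ (1 / p) with hr
    have hrp : r ^ p = 2 := by
      rw [hr, ← Real.rpow_mul (by norm_num), one_div_mul_cancel hp0.ne', Real.rpow_one]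
    have hr1 : 1 ≤ r := Real.one_le_rpow (by norm_num) (by positivity)
    have hr2 : r ^ 2 ≤ 2 := by
      rw [← hrp, ← Real.rpow_natCast]
      exact Real.rpow_le_rpow_of_exponent_le hr1 (by exact_mod_cast hp2)
    have hrt : t + s < r * t := by
      refine (Real.rpow_lt_rpow_iff (by positivity) (by positivity) hp0).1 ?_
      rw [Real.mul_rpow (by positivity) ht.le, hrp]
      by_contra! h
      nlinarith
    have hsr : s ≤ (r - 1) * t := by linarith
    have h1 : (1 + s) ^ p ≤ 3 / 2 := by
      have hconv := (convexOn_rpow hp.le).2 (Set.mem_Ici.2 (zero_le_one (α := ℝ)))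
        (Set.mem_Ici.2 (zero_le_one.trans hr1)) (show (0 : ℝ) ≤ 1 / 2 by norm_num)
        (show (0 : ℝ) ≤ 1 / 2 by norm_num) (by norm_num)
      simp only [smul_eq_mul, Real.one_rpow, hrp] at hconv
      have : (1 + s) ^ p ≤ (1 / 2 * 1 + 1 / 2 * r) ^ p :=
        Real.rpow_le_rpow (by linarith) (by nlinarith) hp0.le
      linarith
    have h2 : s ^ p ≤ (r - 1) ^ 2 * t ^ p := by
      have h3 : s ^ p ≤ ((r - 1) * t) ^ p := Real.rpow_le_rpow hs.le hsr hp0.le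
      rw [Real.mul_rpow (by linarith) ht.le] at h3
      have h4 : (r - 1) ^ p ≤ (r - 1) ^ 2 := by
        rw [← Real.rpow_natCast]
        exact Real.rpow_le_rpow_of_exponent_ge' (by linarith) (by nlinarith) (by norm_num)
          (by exact_mod_cast hp2)
      nlinarith
    have h5 : (r - 1) ^ 2 ≤ 1 / 5 := by nlinarith
    have h6 : 0 ≤ (1 - t) ^ p := Real.rpow_nonneg (by linarith) _
    have h7 : (N - 1) * s ^ p ≤ (r - 1) ^ 2 * ((N - 1) * t ^ p) := by
      calc (N - 1) * s ^ p ≤ (N - 1) * ((r - 1) ^ 2 * t ^ p) :=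
            mul_le_mul_of_nonneg_left h2 (by linarith)
        _ = _ := by ring
    nlinarith

lemma strictConvexOn_abs_rpow {p : ℝ} (hp : 1 < p) :
    StrictConvexOn ℝ Set.univ fun x : ℝ => |x| ^ p := by
  refine ⟨convex_univ, fun x _ y _ hxy a b ha hb hab => ?_⟩
  simp only [smul_eq_mul]
  have hp0 : 0 < p := by linarith
  have htri : |a * x + b * y| ≤ a * |x| + b * |y| := by
    simpa [abs_mul, abs_of_pos ha, abs_of_pos hb] using abs_add_le (a * x) (b * y)
  by_cases h : |x| = |y|
  · rcases abs_eq_abs.1 h with h' | h'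
    · exact absurd h' hxy
    · have hy : y ≠ 0 := fun hy => hxy (by rw [h', hy, neg_zero])
      have : |a * x + b * y| < |y| := by
        rw [h', show a * -y + b * y = (b - a) * y by ring, abs_mul]
        have : |b - a| < 1 := abs_lt.2 ⟨by linarith, by linarith⟩
        nlinarith [abs_pos.2 hy]
      have h2 := Real.rpow_lt_rpow (abs_nonneg _) this hp0
      rw [h]
      calc _ < |y| ^ p := h2
        _ = (a + b) * |y| ^ p := by rw [hab, one_mul]
        _ = _ := by ring
  · refine (Real.rpow_le_rpow (abs_nonneg _) htri hp0.le).trans_lt ?_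
    simpa using (strictConvexOn_rpow hp).2 (abs_nonneg x) (abs_nonneg y) h ha hb hab

lemma strictAnti_abs_sub_one_rpow_sub_abs_rpow {p : ℝ} (hp : 1 < p) :
    StrictAnti fun x : ℝ => |x - 1| ^ p - |x| ^ p := by
  intro x y hxy
  have hpos : 0 < 1 + (y - x) := by linarith
  set a : ℝ := 1 / (1 + (y - x)) with ha
  set b : ℝ := (y - x) / (1 + (y - x)) with hb
  have ha0 : 0 < a := by positivity
  have hb0 : 0 < b := div_pos (by linarith) hpos
  have hab : a + b = 1 := by rw [ha, hb]; field_simp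
  have hne : x - 1 ≠ y := by linarith
  have h1 := (strictConvexOn_abs_rpow hp).2 (Set.mem_univ _) (Set.mem_univ _) hne ha0 hb0 hab
  have h2 := (strictConvexOn_abs_rpow hp).2 (Set.mem_univ _) (Set.mem_univ _) hne hb0 ha0
    (by rw [add_comm, hab])
  simp only [smul_eq_mul] at h1 h2
  rw [show a * (x - 1) + b * y = y - 1 by rw [ha, hb]; field_simp; ring] at h1
  rw [show b * (x - 1) + a * y = x by rw [ha, hb]; field_simp; ring] at h2
  have h3 : a * |x - 1| ^ p + b * |x - 1| ^ p = |x - 1| ^ p := by rw [← add_mul, hab, one_mul]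
  have h4 : a * |y| ^ p + b * |y| ^ p = |y| ^ p := by rw [← add_mul, hab, one_mul]
  simp only
  linarith

lemma sum_abs_sub_single_rpow {d : ℕ} (p : ℝ) (x : Fin d → ℝ) (i : Fin d) :
    ∑ j, |x j - (Pi.single i 1 : Fin d → ℝ) j| ^ p
      = ∑ j, |x j| ^ p + (|x i - 1| ^ p - |x i| ^ p) := by
  rw [← sub_eq_iff_eq_add', ← Finset.sum_sub_distrib, Finset.sum_eq_single i]
  · simp
  · intro j _ hj
    simp [hj]
  · simp

lemma exists_one_add_rpow_add_mul_rpow_eq_two {p N : ℝ} (hp : 1 ≤ p) (hN : 1 ≤ N) :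
    ∃ s : ℝ, 0 < s ∧ (1 + s) ^ p + (N - 1) * s ^ p = 2 := by
  have hp0 : 0 < p := by linarith
  have hcont : ContinuousOn (fun s : ℝ => (1 + s) ^ p + (N - 1) * s ^ p) (Set.Icc 0 1) :=
    Continuous.continuousOn (((continuous_const.add continuous_id).rpow_const
      fun _ => Or.inr hp0.le).add (continuous_const.mul
        (continuous_id.rpow_const fun _ => Or.inr hp0.le)))
  have h2 : (2 : ℝ) ≤ 2 ^ p := by
    simpa using Real.rpow_le_rpow_of_exponent_le (x := 2) (by norm_num) hp
  obtain ⟨s, hs, hgs⟩ := intermediate_value_Icc (by norm_num : (0 : ℝ) ≤ 1) hcont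
    (show (2 : ℝ) ∈ _ by
      constructor
      · simp [Real.zero_rpow hp0.ne']
      · norm_num
        linarith)
  refine ⟨s, hs.1.lt_of_ne ?_, hgs⟩
  rintro rfl
  simp [Real.zero_rpow hp0.ne'] at hgs

open Finset in
lemma exists_finset_of_one_lt {p : ℝ} (hp : 1 < p) {d : ℕ} (hd : 1 ≤ d) :
    ∃ A : Finset (Fin d → ℝ), #A ≤ d + 1 ∧ (∃ a ∈ A, ∃ b ∈ A, a ≠ b) ∧
      (∀ a ∈ A, ∀ b ∈ A, a ≠ b → ∑ i, |a i - b i| ^ p = 2) ∧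
      ∀ x : Fin d → ℝ, ¬ ∀ a ∈ A, ∑ i, |x i - a i| ^ p = 2 := by
  classical
  have hp0 : 0 < p := by linarith
  have hN : (1 : ℝ) ≤ d := by exact_mod_cast hd
  obtain ⟨s, hs, hgs⟩ := exists_one_add_rpow_add_mul_rpow_eq_two hp.le hN
  let e : Fin d → Fin d → ℝ := fun i => Pi.single i 1
  let c : Fin d → ℝ := fun _ => -s
  let i₀ : Fin d := ⟨0, hd⟩
  have hdiag (u : ℝ) (i : Fin d) :
      ∑ j, |u - e i j| ^ p = |1 - u| ^ p + (d - 1) * |u| ^ p := by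
    rw [sum_abs_sub_single_rpow p (fun _ => u) i]
    simp only [sum_const, card_univ, Fintype.card_fin, nsmul_eq_mul, abs_sub_comm u 1]
    ring
  have hce (i : Fin d) : ∑ j, |c j - e i j| ^ p = 2 := by
    rw [hdiag, sub_neg_eq_add, abs_neg, abs_of_pos hs, abs_of_pos (by linarith), hgs]
  have hsymm (a b : Fin d → ℝ) : ∑ j, |a j - b j| ^ p = ∑ j, |b j - a j| ^ p := by
    simp only [abs_sub_comm]
  have he (i : Fin d) : ∑ j, |e i j| ^ p = 1 := by
    have := sum_abs_sub_single_rpow p (0 : Fin d → ℝ) i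
    simpa [Real.zero_rpow hp0.ne'] using this
  have hee (i j : Fin d) (hij : i ≠ j) : ∑ k, |e i k - e j k| ^ p = 2 := by
    rw [sum_abs_sub_single_rpow p (e i) j, he]
    simp [e, hij.symm, Real.zero_rpow hp0.ne']
    norm_num
  refine ⟨insert c (univ.image e), ?_, ?_, ?_, ?_⟩
  · refine (card_insert_le _ _).trans (Nat.succ_le_succ ?_)
    simpa using card_image_le (s := (univ : Finset (Fin d))) (f := e)
  · refine ⟨c, by simp, e i₀, by simp, fun h => ?_⟩
    have := congrFun h i₀
    simp [c, e] at this
    linarith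
  · simp only [mem_insert, mem_image, mem_univ, true_and]
    rintro _ (rfl | ⟨i, rfl⟩) _ (rfl | ⟨j, rfl⟩) hab
    · exact absurd rfl hab
    · exact hce j
    · rw [hsymm]
      exact hce i
    · exact hee i j fun h => hab (by rw [h])
  · intro x hx
    have hxe (i : Fin d) : ∑ j, |x j - e i j| ^ p = 2 := hx _ (by simp)
    have hxc : ∑ j, |x j - c j| ^ p = 2 := hx _ (by simp)
    obtain ⟨u, rfl⟩ : ∃ u, x = fun _ => u := by
      refine ⟨x i₀, funext fun i => (strictAnti_abs_sub_one_rpow_sub_abs_rpow hp).injective ?_⟩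
      have h1 := hxe i
      have h2 := hxe i₀
      rw [sum_abs_sub_single_rpow] at h1 h2
      linarith
    have hgu := hxe i₀
    rw [hdiag] at hgu
    simp only [c, sum_const, card_univ, Fintype.card_fin, nsmul_eq_mul, sub_neg_eq_add] at hxc
    rcases lt_or_ge 0 u with hu | hu
    · rw [abs_of_pos hu] at hgu
      have := two_lt_mul_add_rpow hp hN hs hu hgs hgu
      rw [abs_of_pos (by linarith)] at hxc
      linarith
    · rw [abs_of_nonpos hu, abs_of_pos (by linarith)] at hgu
      have hmono {v w : ℝ} (hv : 0 ≤ v) (hvw : v < w) :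
          (1 + v) ^ p + (d - 1) * v ^ p < (1 + w) ^ p + (d - 1) * w ^ p :=
        add_lt_add_of_lt_of_le (Real.rpow_lt_rpow (by linarith) (by linarith) hp0)
          (mul_le_mul_of_nonneg_left (Real.rpow_le_rpow hv hvw.le hp0.le) (by linarith))
      rw [sub_eq_add_neg] at hgu
      have hus : -u = s := by
        rcases lt_trichotomy (-u) s with h | h | h
        · linarith [hmono (by linarith) h]
        · exact h
        · linarith [hmono hs.le h]
      rw [← hus] at hxc
      simp [Real.zero_rpow hp0.ne'] at hxc

open Finset in
lemma exists_finset_of_eq_one {d : ℕ} (hd : 1 ≤ d) :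
    ∃ A : Finset (Fin d → ℝ), #A ≤ d + 1 ∧ (∃ a ∈ A, ∃ b ∈ A, a ≠ b) ∧
      (∀ a ∈ A, ∀ b ∈ A, a ≠ b → ∑ i, |a i - b i| = 2) ∧
      ∀ x : Fin d → ℝ, ¬ ∀ a ∈ A, ∑ i, |x i - a i| = 2 := by
  classical
  obtain rfl | rfl | hd3 : d = 1 ∨ d = 2 ∨ 3 ≤ d := by omega
  · refine ⟨{![0], ![2]}, card_le_two, ⟨![0], by simp, ![2], by simp, by simp⟩, ?_, ?_⟩
    · simp
    · intro x hx
      simp at hx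
      grind
  · refine ⟨{![0, 0], ![1, 1], ![3 / 2, -1 / 2]}, card_le_three,
      ⟨![0, 0], by simp, ![1, 1], by simp, by simp⟩, ?_, ?_⟩
    · simp only [mem_insert, mem_singleton]
      rintro _ (rfl | rfl | rfl) _ (rfl | rfl | rfl) hab <;>
        first
        | exact absurd rfl hab
        | (simp [Fin.sum_univ_two]; grind)
    · intro x hx
      simp [Fin.sum_univ_two] at hx
      grind
  · obtain ⟨n, rfl⟩ : ∃ n, d = n + 1 := ⟨d - 1, by omega⟩
    have hn : (0 : ℝ) < n := by
      have : 0 < n := by omega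
      exact_mod_cast this
    let c : ℝ := 1 / n
    have hc : 0 < c := by positivity
    have hnc : n * c = 1 := mul_one_div_cancel hn.ne'
    let v : ℝ → ℝ → Fin (n + 1) → ℝ := fun a b => Fin.cons a fun _ => b
    have hv (x : Fin (n + 1) → ℝ) (a b : ℝ) :
        ∑ i, |x i - v a b i| = |x 0 - a| + ∑ i : Fin n, |x i.succ - b| := by
      simp [v, Fin.sum_univ_succ]
    have hvv (a b a' b' : ℝ) :
        ∑ i, |v a b i - v a' b' i| = |a - a'| + n * |b - b'| := by
      simp [v, Fin.sum_univ_succ]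
    refine ⟨{v 1 0, v (-1) 0, v 0 c, v 0 (-c)}, card_le_four.trans (by omega),
      ⟨v 1 0, by simp, v (-1) 0, by simp, fun h => ?_⟩, ?_, ?_⟩
    · have := congrFun h 0
      simp [v] at this
      linarith
    · have hcc : |c + c| = 2 * c := by rw [abs_of_pos (by linarith)]; ring
      have hcc' : |-c - c| = 2 * c := by rw [abs_of_neg (by linarith)]; ring
      simp only [mem_insert, mem_singleton]
      rintro _ (rfl | rfl | rfl | rfl) _ (rfl | rfl | rfl | rfl) hab <;>
        first
        | exact absurd rfl hab
        | (rw [hvv]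
           simp only [sub_neg_eq_add, sub_zero, zero_sub, zero_add, abs_neg, hcc, hcc', abs_one,
             abs_zero, abs_of_pos hc]
           norm_num
           try linarith)
    · intro x hx
      simp only [mem_insert, mem_singleton, forall_eq_or_imp, forall_eq, hv, sub_zero,
        sub_neg_eq_add] at hx
      obtain ⟨h1, h2, h3, h4⟩ := hx
      have hx0 : x 0 = 0 := by
        rcases abs_eq_abs.1 (add_right_cancel (h1.trans h2.symm)) with h | h <;> linarith
      rw [hx0] at h1 h3 h4
      have hS : ∑ i : Fin n, |x i.succ| = 1 := by
        norm_num at h1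
        linarith
      obtain ⟨i, -, hi⟩ : ∃ i ∈ (univ : Finset (Fin n)), |x i.succ| ≠ 0 :=
        exists_ne_zero_of_sum_ne_zero (by rw [hS]; exact one_ne_zero)
      have hlt : ∑ i : Fin n, (|x i.succ - c| + |x i.succ + c|)
          < ∑ i : Fin n, (2 * |x i.succ| + 2 * c) := by
        refine sum_lt_sum (fun j _ => ?_) ⟨i, mem_univ _, ?_⟩
        · clear h1 h2 h3 h4 hv hvv
          grind
        · clear h1 h2 h3 h4 hv hvv
          grind
      rw [sum_add_distrib, sum_add_distrib, ← mul_sum, hS] at hlt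
      simp only [sum_const, card_univ, Fintype.card_fin, nsmul_eq_mul, abs_zero, zero_add]
        at hlt h3 h4
      linarith

/-- For every real `p ≥ 1` and every integer `d ≥ 1`, the space `ℓ_p^d`
contains a maximal equilateral set of cardinality at most `d + 1`; that is,
`m(ℓ_p^d) ≤ d + 1`. -/
theorem statement4 (p : ℝ) (hp : 1 ≤ p) (d : ℕ) (hd : 1 ≤ d) :
    letI : Fact (1 ≤ ENNReal.ofReal p) := ⟨ENNReal.one_le_ofReal.mpr hp⟩
    ∃ A : Set (PiLp (ENNReal.ofReal p) fun _ : Fin d => ℝ),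
      MaximalEquilateral A ∧ A.Finite ∧ A.ncard ≤ d + 1 := by
  obtain ⟨A, hcard, htwo, hdist, hmax⟩ : ∃ A : Finset (Fin d → ℝ), A.card ≤ d + 1 ∧
      (∃ a ∈ A, ∃ b ∈ A, a ≠ b) ∧
      (∀ a ∈ A, ∀ b ∈ A, a ≠ b → ∑ i, |a i - b i| ^ p = 2) ∧
      ∀ x : Fin d → ℝ, ¬ ∀ a ∈ A, ∑ i, |x i - a i| ^ p = 2 := by
    rcases hp.eq_or_lt with rfl | hp1
    · simpa only [Real.rpow_one] using exists_finset_of_eq_one hd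
    · exact exists_finset_of_one_lt hp1 hd
  exact exists_maximalEquilateral_of_finset hp A hcard htwo hdist hmax
end

section
/- Let 1 < p < ∞, let d ≥ 3 be an integer, let 0 < ε ≤ (2d−4)^{−1/(p−1)}, and set R = (1 + ((p−1)/2)ε)^{1/p}. Suppose X = (ℝ^d, ‖·‖) is a normed space such that ‖x‖ ≤ ‖x‖_p ≤ R‖x‖ for all x ∈ ℝ^d. Then X has a λ-equilateral set {p_1, …, p_d} with λ = (2 + (d−2)ε^p)^{1/p}, such that p_i^{(i)} = 1 for all i ∈ [d], −ε ≤ p_i^{(j)} ≤ 0 for all i, j ∈ [d] with j < i, and p_i^{(j)} = 0 for all i, j ∈ [d] with j > i. -/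
theorem sum_erase_comm {ι M : Type*} [DecidableEq ι] [AddCommMonoid M] (S : Finset ι)
    (F : ι → ι → M) :
    ∑ j ∈ S, ∑ m ∈ S.erase j, F j m = ∑ j ∈ S, ∑ m ∈ S.erase j, F m j := by
  apply Finset.sum_comm'
  intro x y
  simp only [Finset.mem_erase]
  tauto

/-- In characteristic two, a symmetric sum over ordered pairs of distinct indices vanishes. -/
theorem sum_erase_eq_zero_of_symm {ι : Type*} [DecidableEq ι] (S : Finset ι)
    (F : ι → ι → ZMod 2) (hF : ∀ j m, F j m = F m j) :
    ∑ j ∈ S, ∑ m ∈ S.erase j, F j m = 0 := by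
  rw [Finset.sum_sigma']
  refine Finset.sum_involution (fun q _ => ⟨q.2, q.1⟩) ?_ ?_ ?_ ?_
  · rintro ⟨j, m⟩ _
    simp only [hF j m]
    exact CharTwo.add_self_eq_zero _
  · rintro ⟨j, m⟩ h _ heq
    simp only [Finset.mem_sigma, Finset.mem_erase] at h
    exact h.2.1 (congrArg Sigma.fst heq)
  · rintro ⟨j, m⟩ h
    simp only [Finset.mem_sigma, Finset.mem_erase] at h ⊢
    tauto
  · rintro ⟨j, m⟩ _
    rfl

/-- The value, on the cell with lowest vertex `x` and edge directions `S`, of the cup product of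
the coboundaries of the vertex labellings `a i`, `i ∈ l`, with coefficients in `ZMod 2`: the sum
over all monotone edge paths along the cell of the products of the successive label changes. -/
def cellCup {ι : Type*} [DecidableEq ι] (a : ι → (ι → ℕ) → ZMod 2) :
    List ι → Finset ι → (ι → ℕ) → ZMod 2
  | [], _, _ => 1
  | i :: l, S, x => ∑ j ∈ S, (a i (x + Pi.single j 1) + a i x) *
      cellCup a l (S.erase j) (x + Pi.single j 1)

section cellCup

variable {ι : Type*} [DecidableEq ι] (a : ι → (ι → ℕ) → ZMod 2)

/-- The cup product of coboundaries is closed. -/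
theorem sum_cellCup_erase_add_single (l : List ι) (S : Finset ι) (x : ι → ℕ) :
    ∑ j ∈ S, cellCup a l (S.erase j) (x + Pi.single j 1) =
      ∑ j ∈ S, cellCup a l (S.erase j) x := by
  induction l generalizing S x with
  | nil => simp [cellCup]
  | cons i l ih =>
    simp only [cellCup, add_mul, Finset.sum_add_distrib]
    have h1 : ∑ j ∈ S, ∑ m ∈ S.erase j, a i (x + Pi.single j 1 + Pi.single m 1) *
        cellCup a l ((S.erase j).erase m) (x + Pi.single j 1 + Pi.single m 1) = 0 := by
      apply sum_erase_eq_zero_of_symm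
      intro j m
      rw [Finset.erase_right_comm, add_right_comm]
    have h2 : ∑ j ∈ S, ∑ m ∈ S.erase j, a i (x + Pi.single j 1) *
        cellCup a l ((S.erase j).erase m) (x + Pi.single j 1 + Pi.single m 1) =
        ∑ j ∈ S, ∑ m ∈ S.erase j, a i (x + Pi.single m 1) *
          cellCup a l ((S.erase j).erase m) (x + Pi.single m 1) := by
      refine Eq.trans ?_ (sum_erase_comm S (fun j m => a i (x + Pi.single j 1) *
        cellCup a l ((S.erase m).erase j) (x + Pi.single j 1)))
      refine Finset.sum_congr rfl fun j _ => ?_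
      simp only [← Finset.mul_sum]
      rw [ih]
      simp only [Finset.erase_right_comm (a := j)]
    have h3 : ∑ j ∈ S, ∑ m ∈ S.erase j, a i x *
        cellCup a l ((S.erase j).erase m) (x + Pi.single m 1) = 0 := by
      simp only [← Finset.mul_sum, ih]
      rw [sum_erase_eq_zero_of_symm, mul_zero]
      intro j m
      rw [Finset.erase_right_comm]
    rw [h1, h2, h3, zero_add, add_zero]

/-- The cup product of coboundaries is itself a coboundary. -/
theorem cellCup_cons (i : ι) (l : List ι) (S : Finset ι) (x : ι → ℕ) :
    cellCup a (i :: l) S x = ∑ j ∈ S,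
      (a i (x + Pi.single j 1) * cellCup a l (S.erase j) (x + Pi.single j 1) +
        a i x * cellCup a l (S.erase j) x) := by
  simp only [cellCup, add_mul, Finset.sum_add_distrib, ← Finset.mul_sum,
    sum_cellCup_erase_add_single]

/-- If the cup product does not vanish on a cell, then no labelling is constant on the cell. -/
theorem exists_ne_of_cellCup_ne_zero {l : List ι} {S : Finset ι} {x : ι → ℕ}
    (h : cellCup a l S x ≠ 0) :
    ∀ i ∈ l, ∃ u v : ι → ℕ, (∀ j, x j ≤ u j ∧ u j ≤ x j + if j ∈ S then 1 else 0) ∧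
      (∀ j, x j ≤ v j ∧ v j ≤ x j + if j ∈ S then 1 else 0) ∧ a i u ≠ a i v := by
  induction l generalizing S x with
  | nil => simp
  | cons i l ih =>
    obtain ⟨j, hj, hne⟩ := Finset.exists_ne_zero_of_sum_ne_zero h
    have hbd : ∀ m, (x + Pi.single j 1 : ι → ℕ) m + (if m ∈ S.erase j then 1 else 0) =
        x m + if m ∈ S then 1 else 0 := by
      intro m
      by_cases hm : m = j
      · subst hm; simp [hj]
      · simp [hm]
    intro i' hi'
    rcases List.mem_cons.1 hi' with rfl | hi'
    · refine ⟨x + Pi.single j 1, x, fun m => ⟨by simp, ?_⟩, fun m => ⟨le_rfl, by simp⟩, ?_⟩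
      · rw [← hbd]; simp
      · intro heq
        rw [heq, CharTwo.add_self_eq_zero, zero_mul] at hne
        exact hne rfl
    · obtain ⟨u, v, hu, hv, huv⟩ := ih (right_ne_zero_of_mul hne) i' hi'
      simp only [hbd] at hu hv
      exact ⟨u, v, fun m => ⟨le_trans (by simp) (hu m).1, (hu m).2⟩,
        fun m => ⟨le_trans (by simp) (hv m).1, (hv m).2⟩, huv⟩

variable {a} {k : ℕ}

theorem cellCup_eq_zero_of_face (h0 : ∀ i x, x i = 0 → a i x = 0) (hk : ∀ i x, x i = k → a i x = 1)
    {l : List ι} {S : Finset ι} {x : ι → ℕ} {j : ι} (hjl : j ∈ l) (hjS : j ∉ S)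
    (hx : x j = 0 ∨ x j = k) : cellCup a l S x = 0 := by
  induction l generalizing S x with
  | nil => simp at hjl
  | cons i l ih =>
    refine Finset.sum_eq_zero fun m hm => ?_
    have hmj : j ≠ m := fun h => hjS (h ▸ hm)
    have hxm : (x + Pi.single m 1 : ι → ℕ) j = x j := by simp [hmj]
    rcases List.mem_cons.1 hjl with rfl | hjl
    · rw [show a j (x + Pi.single m 1) = a j x from ?_, CharTwo.add_self_eq_zero, zero_mul]
      rcases hx with hx | hx
      · rw [h0 _ _ hx, h0 _ _ (hxm.trans hx)]
      · rw [hk _ _ hx, hk _ _ (hxm.trans hx)]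
    · rw [ih hjl (fun h => hjS (Finset.mem_of_mem_erase h)) (by rwa [hxm]), mul_zero]

variable [Fintype ι]

/-- The grid points in `[0, k)` along `S` which agree with `y` off `S`. -/
def gridBox (k : ℕ) (S : Finset ι) (y : ι → ℕ) : Finset (ι → ℕ) :=
  Fintype.piFinset fun i => if i ∈ S then Finset.range k else {y i}

theorem mem_gridBox {S : Finset ι} {x y : ι → ℕ} :
    x ∈ gridBox k S y ↔ ∀ i, if i ∈ S then x i < k else x i = y i := by
  simp only [gridBox, Fintype.mem_piFinset]
  refine forall_congr' fun i => ?_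
  split_ifs <;> simp

theorem sum_gridBox {M : Type*} [AddCommMonoid M] {S : Finset ι} {j : ι} (hj : j ∈ S)
    (y : ι → ℕ) (g : (ι → ℕ) → M) :
    ∑ x ∈ gridBox k S y, g x =
      ∑ x ∈ gridBox k (S.erase j) y, ∑ c ∈ Finset.range k, g (Function.update x j c) := by
  rw [← Finset.sum_product']
  refine Finset.sum_bij' (fun x _ => (Function.update x j (y j), x j))
    (fun q _ => Function.update q.1 j q.2) ?_ ?_ ?_ ?_ ?_
  · intro x hx
    rw [mem_gridBox] at hx
    simp only [Finset.mem_product, mem_gridBox, Finset.mem_range]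
    refine ⟨fun i => ?_, by simpa [hj] using hx j⟩
    by_cases hi : i = j
    · subst hi; simp
    · simpa [hi] using hx i
  · rintro ⟨x, c⟩ hx
    simp only [Finset.mem_product, mem_gridBox, Finset.mem_range] at hx
    rw [mem_gridBox]
    intro i
    by_cases hi : i = j
    · subst hi; simpa [hj] using hx.2
    · simpa [hi] using hx.1 i
  · intro x _; simp
  · rintro ⟨x, c⟩ hx
    simp only [Finset.mem_product, mem_gridBox] at hx
    have := hx.1 j
    simp only [Finset.mem_erase, ne_eq, not_true_eq_false, false_and, if_false] at this
    simp [← this]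
  · intro x _; simp

/-- Telescoping along one coordinate direction. -/
theorem sum_gridBox_telescope {S : Finset ι} {j : ι} (hj : j ∈ S) (y : ι → ℕ)
    (g : (ι → ℕ) → ZMod 2) :
    ∑ x ∈ gridBox k S y, (g (x + Pi.single j 1) + g x) =
      ∑ x ∈ gridBox k (S.erase j) y,
        (g (Function.update x j k) + g (Function.update x j 0)) := by
  rw [sum_gridBox hj]
  refine Finset.sum_congr rfl fun x _ => ?_
  have h : ∀ c, Function.update x j c + Pi.single j 1 = Function.update x j (c + 1) := by
    intro c
    ext m
    by_cases hm : m = j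
    · subst hm; simp
    · simp [hm]
  simp only [h, ← CharTwo.sub_eq_add]
  exact Finset.sum_range_sub (fun c => g (Function.update x j c)) k

/-- The total cup product over the grid is one. -/
theorem sum_gridBox_cellCup (h0 : ∀ i x, x i = 0 → a i x = 0) (hk : ∀ i x, x i = k → a i x = 1) (l : List ι) (hl : l.Nodup) (y : ι → ℕ) :
    ∑ x ∈ gridBox k l.toFinset y, cellCup a l l.toFinset x = 1 := by
  induction l generalizing y with
  | nil =>
    have : gridBox k ∅ y = {y} := by
      ext x; simp [mem_gridBox, funext_iff]
    simp [cellCup, this]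
  | cons i l ih =>
    obtain ⟨hil, hl⟩ := List.nodup_cons.1 hl
    set S := (i :: l).toFinset with hS
    have hiS : i ∈ S := by simp [hS]
    have hSi : S.erase i = l.toFinset := by
      rw [hS, List.toFinset_cons, Finset.erase_insert (by simpa using hil)]
    simp only [cellCup_cons]
    rw [Finset.sum_comm]
    have htel : ∀ j ∈ S, ∑ x ∈ gridBox k S y,
        (a i (x + Pi.single j 1) * cellCup a l (S.erase j) (x + Pi.single j 1) +
          a i x * cellCup a l (S.erase j) x) = ∑ x ∈ gridBox k (S.erase j) y,
          (a i (Function.update x j k) * cellCup a l (S.erase j) (Function.update x j k) +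
          a i (Function.update x j 0) * cellCup a l (S.erase j) (Function.update x j 0)) :=
      fun j hj => sum_gridBox_telescope hj y
        (fun x => a i x * cellCup a l (S.erase j) x)
    rw [Finset.sum_congr rfl htel, Finset.sum_eq_single_of_mem i hiS]
    · rw [hSi, ← ih hl (Function.update y i k)]
      refine Finset.sum_bij' (fun x _ => Function.update x i k) (fun x _ => Function.update x i (y i))
        ?_ ?_ ?_ ?_ ?_
      · intro x hx
        rw [mem_gridBox] at hx ⊢
        intro m
        by_cases hm : m = i
        · subst hm; simp [hil]
        · simpa [hm] using hx m
      · intro x hx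
        rw [mem_gridBox] at hx ⊢
        intro m
        by_cases hm : m = i
        · subst hm; simp [hil]
        · simpa [hm] using hx m
      · intro x hx
        have := mem_gridBox.1 hx i
        simp only [List.mem_toFinset, hil, if_false] at this
        simp [← this]
      · intro x hx
        have := mem_gridBox.1 hx i
        simp only [List.mem_toFinset, hil, if_false, Function.update_self] at this
        simp [← this]
      · intro x _
        rw [hk i _ (by simp), h0 i (Function.update x i 0) (by simp)]
        ring
    · intro j hj hji
      have hjl : j ∈ l := by simpa [hS, hji] using hj
      refine Finset.sum_eq_zero fun x _ => ?_
      rw [cellCup_eq_zero_of_face h0 hk hjl (by simp) (Or.inr (by simp)),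
        cellCup_eq_zero_of_face h0 hk hjl (by simp) (Or.inl (by simp))]
      ring

/-- A combinatorial form of the Poincaré–Miranda theorem: some cell of the grid carries
no constant labelling. -/
theorem exists_cell_forall_ne (h0 : ∀ i x, x i = 0 → a i x = 0)
    (hk : ∀ i x, x i = k → a i x = 1) :
    ∃ x : ι → ℕ, (∀ i, x i < k) ∧ ∀ i, ∃ u v : ι → ℕ, (∀ j, x j ≤ u j ∧ u j ≤ x j + 1) ∧
      (∀ j, x j ≤ v j ∧ v j ≤ x j + 1) ∧ a i u = 0 ∧ a i v = 1 := by
  have h := sum_gridBox_cellCup h0 hk (Finset.univ : Finset ι).toList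
    (Finset.nodup_toList _) 0
  rw [Finset.toList_toFinset] at h
  obtain ⟨x, hx, hne⟩ := Finset.exists_ne_zero_of_sum_ne_zero (h.trans_ne one_ne_zero)
  refine ⟨x, fun i => by simpa using mem_gridBox.1 hx i, fun i => ?_⟩
  obtain ⟨u, v, hu, hv, huv⟩ := exists_ne_of_cellCup_ne_zero a hne i (by simp)
  simp only [Finset.mem_univ, if_true] at hu hv
  have key : ∀ s t : ZMod 2, s ≠ t → (s = 0 ∧ t = 1) ∨ (t = 0 ∧ s = 1) := by decide
  rcases key _ _ huv with h | h
  · exact ⟨u, v, hu, hv, h⟩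
  · exact ⟨v, u, hv, hu, h⟩

end cellCup

/-- The **Poincaré–Miranda theorem** on the unit cube. -/
theorem exists_forall_eq_zero_of_cube {ι : Type*} [Fintype ι] (f : ι → (ι → ℝ) → ℝ)
    (hf : ∀ i, Continuous (f i))
    (h0 : ∀ i, ∀ z ∈ Set.Icc (0 : ι → ℝ) 1, z i = 0 → f i z ≤ 0)
    (h1 : ∀ i, ∀ z ∈ Set.Icc (0 : ι → ℝ) 1, z i = 1 → 0 ≤ f i z) :
    ∃ z ∈ Set.Icc (0 : ι → ℝ) 1, ∀ i, f i z = 0 := by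
  classical
  have hcell : ∀ n : ℕ, ∃ z ∈ Set.Icc (0 : ι → ℝ) 1, ∀ i, ∃ u v : ι → ℝ,
      dist u z ≤ 1 / ((n : ℝ) + 1) ∧ dist v z ≤ 1 / ((n : ℝ) + 1) ∧ f i u ≤ 0 ∧ 0 ≤ f i v := by
    intro n
    have hn : (0 : ℝ) < (n : ℝ) + 1 := by positivity
    let r : (ι → ℕ) → ι → ℝ := fun x j => (x j : ℝ) / ((n : ℝ) + 1)
    let a : ι → (ι → ℕ) → ZMod 2 := fun i x =>
      if x i = 0 then 0 else if x i = n + 1 then 1 else if f i (r x) ≤ 0 then 0 else 1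
    have hr : ∀ x : ι → ℕ, (∀ j, x j ≤ n + 1) → r x ∈ Set.Icc (0 : ι → ℝ) 1 := by
      intro x hx
      refine ⟨fun j => by simp only [r, Pi.zero_apply]; positivity, fun j => ?_⟩
      simp only [r, Pi.one_apply, div_le_one hn]
      exact_mod_cast hx j
    have hdist : ∀ x u : ι → ℕ, (∀ j, x j ≤ u j ∧ u j ≤ x j + 1) →
        dist (r u) (r x) ≤ 1 / ((n : ℝ) + 1) := by
      intro x u hu
      rw [dist_pi_le_iff (by positivity)]
      intro j
      have e1 : (x j : ℝ) ≤ u j := by exact_mod_cast (hu j).1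
      have e2 : (u j : ℝ) ≤ x j + 1 := by exact_mod_cast (hu j).2
      simp only [r, Real.dist_eq, ← sub_div, abs_div, abs_of_pos hn]
      gcongr
      rw [abs_le]
      constructor <;> linarith
    obtain ⟨x, hx, huv⟩ := exists_cell_forall_ne (a := a) (k := n + 1)
      (fun i x h => by simp [a, h]) (fun i x h => by simp [a, h])
    refine ⟨r x, hr x fun j => (hx j).le, fun i => ?_⟩
    obtain ⟨u, v, hu, hv, hau, hav⟩ := huv i
    refine ⟨r u, r v, hdist x u hu, hdist x v hv, ?_, ?_⟩
    · have hru := hr u fun j => by have := hu j; have := hx j; omega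
      by_cases hui : u i = 0
      · exact h0 i _ hru (by simp [r, hui])
      · by_contra hc
        simp only [a, hui, if_false, hc] at hau
        split_ifs at hau <;> simp at hau
    · have hrv := hr v fun j => by have := hv j; have := hx j; omega
      by_cases hvi : v i = n + 1
      · exact h1 i _ hrv (by simp [r, hvi, hn.ne'])
      · by_contra hc
        simp [a, hvi, (not_le.1 hc).le] at hav
  choose z hz u v hu hv hfu hfv using hcell
  obtain ⟨z₀, hz₀, φ, hφ, hlim⟩ := isCompact_Icc.tendsto_subseq hz
  refine ⟨z₀, hz₀, fun i => ?_⟩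
  have hsmall : Filter.Tendsto (fun n => 1 / ((φ n : ℝ) + 1)) Filter.atTop (nhds 0) :=
    tendsto_one_div_add_atTop_nhds_zero_nat.comp hφ.tendsto_atTop
  have hclose : ∀ w : ℕ → ι → ℝ, (∀ n, dist (w n) (z n) ≤ 1 / ((n : ℝ) + 1)) →
      Filter.Tendsto (fun n => f i (w (φ n))) Filter.atTop (nhds (f i z₀)) := by
    intro w hw
    refine ((hf i).tendsto z₀).comp (hlim.congr_dist ?_)
    refine squeeze_zero (fun _ => dist_nonneg) (fun n => ?_) hsmall
    rw [dist_comm]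
    exact hw (φ n)
  exact le_antisymm
    (le_of_tendsto' (hclose (fun n => u n i) fun n => hu n i) fun n => hfu (φ n) i)
    (ge_of_tendsto' (hclose (fun n => v n i) fun n => hv n i) fun n => hfv (φ n) i)

theorem IsNorm.continuous_of_le {d : ℕ} {N : (Fin d → ℝ) → ℝ} (hN : IsNorm N) {p : ℝ} (hp : 0 < p)
    (hle : ∀ x, N x ≤ (∑ i, |x i| ^ p) ^ (1 / p)) : Continuous N := by
  have hneg : ∀ x, N (-x) = N x := fun x => by
    rw [← neg_one_smul ℝ x, hN.smul]; simp
  have hsub : ∀ x y, N x - N y ≤ N (x - y) := fun x y => by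
    have := hN.add_le (x - y) y
    rw [sub_add_cancel] at this
    linarith
  refine continuous_iff_continuousAt.2 fun x₀ => ?_
  have hc : Continuous fun x : Fin d → ℝ => (∑ i, |(x - x₀) i| ^ p) ^ (1 / p) := by
    refine Continuous.rpow_const ?_ fun _ => Or.inr (by positivity)
    refine continuous_finsetSum _ fun i _ => Continuous.rpow_const ?_ fun _ => Or.inr hp.le
    simp only [Pi.sub_apply]
    fun_prop
  have ht := hc.tendsto x₀
  simp only [sub_self, Pi.zero_apply, abs_zero, Real.zero_rpow hp.ne', Finset.sum_const_zero,
    Real.zero_rpow (one_div_pos.2 hp).ne'] at ht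
  rw [ContinuousAt, tendsto_iff_dist_tendsto_zero]
  refine squeeze_zero (fun _ => dist_nonneg) (fun x => ?_) ht
  refine le_trans ?_ (hle (x - x₀))
  rw [Real.dist_eq, abs_le]
  have h1 := hsub x x₀
  have h2 := hsub x₀ x
  rw [← hneg (x₀ - x), neg_sub] at h2
  constructor <;> linarith

/-- The numerical inequality behind the lower bound on the distances. -/
theorem two_add_mul_le_one_add_rpow {p : ℝ} (hp : 1 < p) {d ε : ℝ} (hd : 3 ≤ d) (hε0 : 0 < ε)
    (hε : ε ≤ (2 * d - 4) ^ (-(1 / (p - 1)))) :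
    (1 + (p - 1) / 2 * ε) * (2 + (d - 2) * ε ^ p) ≤ 1 + (1 + ε) ^ p := by
  have hp1 : 0 < p - 1 := by linarith
  have hd4 : 0 < 2 * d - 4 := by linarith
  have hpow : ε ^ (p - 1) ≤ (2 * d - 4)⁻¹ := by
    calc ε ^ (p - 1) ≤ ((2 * d - 4) ^ (-(1 / (p - 1)))) ^ (p - 1) :=
          Real.rpow_le_rpow hε0.le hε hp1.le
      _ = (2 * d - 4)⁻¹ := by
          rw [← Real.rpow_mul hd4.le, ← Real.rpow_neg_one]
          congr 1
          field_simp
  have hεp : (d - 2) * ε ^ p ≤ ε / 2 := by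
    have h1 : ε ^ p = ε ^ (p - 1) * ε := by
      rw [← Real.rpow_add_one hε0.ne']; congr 1; ring
    have h2 : (d - 2) * (2 * d - 4)⁻¹ = 1 / 2 := by
      rw [← div_eq_mul_inv, div_eq_div_iff hd4.ne' two_ne_zero]; ring
    calc (d - 2) * ε ^ p = (d - 2) * ε ^ (p - 1) * ε := by rw [h1]; ring
      _ ≤ (d - 2) * (2 * d - 4)⁻¹ * ε := by gcongr; linarith
      _ = ε / 2 := by rw [h2]; ring
  have hlow : 1 + p * ε + (p - 1) * ε ^ 2 / 4 - ε / 2 ≤ (1 + ε) ^ p := by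
    rcases le_total p 2 with h2 | h2
    · have hε1 : ε ≤ 1 := hε.trans (Real.rpow_le_one_of_one_le_of_nonpos (by linarith)
        (neg_nonpos.2 (by positivity)))
      have := one_add_mul_self_le_rpow_one_add (by linarith : (-1 : ℝ) ≤ ε) hp.le
      nlinarith [mul_nonneg hε0.le (sub_nonneg.2 hε1), mul_nonneg (sub_nonneg.2 h2) (sq_nonneg ε)]
    · have := one_add_mul_self_le_rpow_one_add (by linarith : (-1 : ℝ) ≤ ε)
        (by linarith : 1 ≤ p - 1)
      have h1 : (1 + ε) ^ p = (1 + ε) ^ (p - 1) * (1 + ε) := by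
        rw [← Real.rpow_add_one (by linarith)]; congr 1; ring
      rw [h1]
      nlinarith [mul_le_mul_of_nonneg_right this (by linarith : 0 ≤ 1 + ε),
        mul_nonneg hp1.le (sq_nonneg ε)]
  have hR : 0 < 1 + (p - 1) / 2 * ε := by positivity
  nlinarith [mul_le_mul_of_nonneg_left hεp hR.le]

/-- The lower triangular configuration with unit diagonal and entries `-ε z (i, j)` below it. -/
def triangularPoint {d : ℕ} (ε : ℝ) (z : Fin d × Fin d → ℝ) (i j : Fin d) : ℝ :=
  if j < i then -(ε * z (i, j)) else if i = j then 1 else 0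

section triangularPoint

variable {d : ℕ} {ε : ℝ} {z : Fin d × Fin d → ℝ}

theorem triangularPoint_self (i : Fin d) : triangularPoint ε z i i = 1 := by
  simp [triangularPoint]

theorem triangularPoint_of_lt {i j : Fin d} (h : i < j) : triangularPoint ε z i j = 0 := by
  simp [triangularPoint, h.not_gt, h.ne]

theorem triangularPoint_mem_Icc (hε : 0 ≤ ε) (hz : z ∈ Set.Icc (0 : Fin d × Fin d → ℝ) 1)
    {i j : Fin d} (h : i ≠ j) : triangularPoint ε z i j ∈ Set.Icc (-ε) 0 := by
  have h0 : 0 ≤ z (i, j) := hz.1 (i, j)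
  have h1 : z (i, j) ≤ 1 := hz.2 (i, j)
  simp only [triangularPoint, h, if_false]
  split_ifs
  · constructor <;> nlinarith
  · exact ⟨by linarith, le_rfl⟩

theorem continuous_triangularPoint (i : Fin d) : Continuous fun z => triangularPoint ε z i := by
  refine continuous_pi fun j => ?_
  unfold triangularPoint
  split_ifs <;> fun_prop

theorem sum_sub_rpow_le {p : ℝ} (hp : 0 ≤ p) (hε : 0 ≤ ε)
    (hz : z ∈ Set.Icc (0 : Fin d × Fin d → ℝ) 1) {i j : Fin d} (hji : j < i) (h : z (i, j) = 0) :
    ∑ m, |(triangularPoint ε z i - triangularPoint ε z j) m| ^ p ≤ 2 + ((d : ℝ) - 2) * ε ^ p := by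
  have hsum : ∑ m : Fin d, (ε ^ p + ((if m = i then 1 - ε ^ p else 0) +
      if m = j then 1 - ε ^ p else 0)) = 2 + ((d : ℝ) - 2) * ε ^ p := by
    simp [Finset.sum_add_distrib]
    ring
  rw [← hsum]
  refine Finset.sum_le_sum fun m _ => ?_
  rw [Pi.sub_apply]
  by_cases hmi : m = i
  · subst hmi
    simp [triangularPoint_self, triangularPoint_of_lt hji, hji.ne']
  by_cases hmj : m = j
  · subst hmj
    simp [triangularPoint, hji, h, hji.ne]
  · have h1 := triangularPoint_mem_Icc hε hz (Ne.symm hmi)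
    have h2 := triangularPoint_mem_Icc hε hz (Ne.symm hmj)
    simp only [hmi, hmj, if_false, add_zero]
    refine Real.rpow_le_rpow (abs_nonneg _) (abs_le.2 ⟨?_, ?_⟩) hp
    · linarith [h1.1, h2.2]
    · linarith [h1.2, h2.1]

theorem le_sum_sub_rpow {p : ℝ} (hε : 0 ≤ ε) {i j : Fin d} (hji : j < i) (h : z (i, j) = 1) :
    1 + (1 + ε) ^ p ≤ ∑ m, |(triangularPoint ε z i - triangularPoint ε z j) m| ^ p := by
  have hle := Finset.sum_le_univ_sum_of_nonneg (s := {i, j})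
    (f := fun m => |(triangularPoint ε z i - triangularPoint ε z j) m| ^ p)
    (fun m => by positivity)
  rw [Finset.sum_pair hji.ne'] at hle
  refine le_trans (le_of_eq ?_) hle
  have hj : triangularPoint ε z i j - triangularPoint ε z j j = -(1 + ε) := by
    simp only [triangularPoint, hji, h, if_true, lt_irrefl, if_false]; ring
  rw [Pi.sub_apply, Pi.sub_apply, hj, triangularPoint_self, triangularPoint_of_lt hji, abs_neg,
    abs_of_nonneg (by linarith : 0 ≤ 1 + ε)]
  simp

end triangularPoint

/-- Let `1 < p < ∞`, `d ≥ 3`, `0 < ε ≤ (2d−4)^{−1/(p−1)}`, and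
`R = (1 + ((p−1)/2)ε)^{1/p}`. If `N` is a norm on `ℝ^d` with
`N x ≤ ‖x‖_p ≤ R · N x` for all `x`, then `(ℝ^d, N)` has a `λ`-equilateral set
`{p_1, …, p_d}` with `λ = (2 + (d−2)ε^p)^{1/p}`, where `p_i^{(i)} = 1`,
`−ε ≤ p_i^{(j)} ≤ 0` for `j < i`, and `p_i^{(j)} = 0` for `j > i`. -/
theorem statement8 (p : ℝ) (hp : 1 < p) (d : ℕ) (hd : 3 ≤ d)
    (ε : ℝ) (hε0 : 0 < ε) (hε : ε ≤ (2 * (d : ℝ) - 4) ^ (-(1 / (p - 1))))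
    (N : (Fin d → ℝ) → ℝ) (hN : IsNorm N)
    (hbound : ∀ x : Fin d → ℝ,
      N x ≤ (∑ i, |x i| ^ p) ^ (1 / p) ∧
      (∑ i, |x i| ^ p) ^ (1 / p) ≤ (1 + (p - 1) / 2 * ε) ^ (1 / p) * N x) :
    ∃ P : Fin d → Fin d → ℝ,
      (∀ i j : Fin d, i ≠ j → N (P i - P j) = (2 + ((d : ℝ) - 2) * ε ^ p) ^ (1 / p)) ∧
      (∀ i : Fin d, P i i = 1) ∧
      (∀ i j : Fin d, (j : ℕ) < (i : ℕ) → -ε ≤ P i j ∧ P i j ≤ 0) ∧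
      (∀ i j : Fin d, (i : ℕ) < (j : ℕ) → P i j = 0) := by
  have hp0 : 0 < p := by linarith
  have hp0' : 0 ≤ 1 / p := by positivity
  have hd3 : (3 : ℝ) ≤ d := by exact_mod_cast hd
  have hNc : Continuous N := hN.continuous_of_le hp0 fun x => (hbound x).1
  have hlam : 0 ≤ 2 + ((d : ℝ) - 2) * ε ^ p := by
    have : 0 ≤ ((d : ℝ) - 2) * ε ^ p := mul_nonneg (by linarith) (by positivity)
    linarith
  have hR : 0 < 1 + (p - 1) / 2 * ε := by
    have : 0 < (p - 1) / 2 * ε := mul_pos (by linarith) hε0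
    linarith
  have hzero : ∃ z ∈ Set.Icc (0 : Fin d × Fin d → ℝ) 1, ∀ q : Fin d × Fin d,
      (if q.2 < q.1 then N (triangularPoint ε z q.1 - triangularPoint ε z q.2) -
        (2 + ((d : ℝ) - 2) * ε ^ p) ^ (1 / p) else z q - 1 / 2) = 0 := by
    apply exists_forall_eq_zero_of_cube
    · rintro ⟨i, j⟩
      have hi := continuous_triangularPoint (ε := ε) i
      have hj := continuous_triangularPoint (ε := ε) j
      dsimp only
      split_ifs <;> fun_prop
    · rintro ⟨i, j⟩ z hz h
      dsimp only
      split_ifs with hji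
      · refine sub_nonpos.2 ((hbound _).1.trans ?_)
        exact Real.rpow_le_rpow (by positivity) (sum_sub_rpow_le hp0.le hε0.le hz hji h) hp0'
      · rw [h]; norm_num
    · rintro ⟨i, j⟩ z hz h
      dsimp only
      split_ifs with hji
      · refine sub_nonneg.2 (le_of_mul_le_mul_left ?_ (Real.rpow_pos_of_pos hR (1 / p)))
        refine le_trans ?_ (hbound _).2
        rw [← Real.mul_rpow hR.le hlam]
        exact Real.rpow_le_rpow (mul_nonneg hR.le hlam)
          ((two_add_mul_le_one_add_rpow hp hd3 hε0 hε).trans (le_sum_sub_rpow hε0.le hji h)) hp0'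
      · rw [h]; norm_num
  obtain ⟨z, hz, hfz⟩ := hzero
  have hlt : ∀ i j : Fin d, j < i → N (triangularPoint ε z i - triangularPoint ε z j) =
      (2 + ((d : ℝ) - 2) * ε ^ p) ^ (1 / p) := by
    intro i j hji
    have := hfz (i, j)
    simp only [hji, if_true] at this
    linarith
  refine ⟨triangularPoint ε z, fun i j hij => ?_, triangularPoint_self, fun i j hji => ?_,
    fun i j hij => triangularPoint_of_lt hij⟩
  · rcases lt_or_gt_of_ne hij with h | h
    · rw [← hlt j i h, ← neg_sub, ← neg_one_smul ℝ, hN.smul]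
      simp
    · exact hlt i j h
  · exact triangularPoint_mem_Icc hε0.le hz (Fin.lt_def.2 hji).ne'
end

section
/- Let X be a normed space of dimension at least 2 whose unit sphere contains a smooth point, i.e. a unit vector u admitting exactly one continuous linear functional f on X with ‖f‖ = 1 and f(u) = 1. Then m(X ⊕_1 ℝ) = 4. -/
section ThirdPoint

open Set

variable {E : Type*} [NormedAddCommGroup E] [NormedSpace ℝ E]

lemma convexOn_norm_add_smul (x d : E) : ConvexOn ℝ univ fun t : ℝ => ‖x + t • d‖ := by
  refine ⟨convex_univ, fun s _ t _ a b ha hb hab => ?_⟩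
  have h : x + (a • s + b • t) • d = a • (x + s • d) + b • (x + t • d) := by
    have hx : x = (a + b) • x := by rw [hab, one_smul]
    nth_rewrite 1 [hx]
    simp only [smul_eq_mul]
    module
  calc ‖x + (a • s + b • t) • d‖ ≤ ‖a • (x + s • d)‖ + ‖b • (x + t • d)‖ := by
        rw [h]; exact norm_add_le _ _
    _ = a • ‖x + s • d‖ + b • ‖x + t • d‖ := by
        rw [norm_smul, norm_smul, Real.norm_of_nonneg ha, Real.norm_of_nonneg hb]; rfl

/-- If a convex function takes the value `1` at `t - 1` and at `t`, then any other two points at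
distance `1` cannot both have value less than `1`. -/
lemma ConvexOn.one_le_of_eq_one {g : ℝ → ℝ} (hg : ConvexOn ℝ univ g) {s t : ℝ}
    (h₁ : g (t - 1) = 1) (h₂ : g t = 1) (h₃ : g (s - 1) < 1) : 1 ≤ g s := by
  by_contra! h₄
  rcases lt_trichotomy s t with h | h | h
  · have hmem : t - 1 ∈ openSegment ℝ (s - 1) t := by
      rw [openSegment_eq_Ioo (by linarith)]; constructor <;> linarith
    have := hg.lt_right_of_left_lt (mem_univ _) (mem_univ _) hmem (by linarith)
    linarith
  · subst h; linarith
  · have hmem : t ∈ openSegment ℝ (t - 1) s := by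
      rw [openSegment_eq_Ioo (by linarith)]; constructor <;> linarith
    have := hg.lt_left_of_right_lt (mem_univ _) (mem_univ _) hmem (by linarith)
    linarith

lemma ConvexOn.ordConnected_eq_one {g : ℝ → ℝ} (hg : ConvexOn ℝ univ g) :
    OrdConnected {t | g t = 1 ∧ g (t - 1) = 1} := by
  refine ⟨?_⟩
  rintro a ⟨ha, ha'⟩ b ⟨hb, hb'⟩ t ⟨hat, htb⟩
  rcases hat.eq_or_lt with rfl | hat
  · exact ⟨ha, ha'⟩
  rcases htb.eq_or_lt with rfl | htb
  · exact ⟨hb, hb'⟩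
  have upper : ∀ {x y z : ℝ}, x < z → z < y → g x = 1 → g y = 1 → g z ≤ 1 := by
    intro x y z hxz hzy hx hy
    have := hg.le_max_of_mem_Icc (mem_univ x) (mem_univ y) ⟨hxz.le, hzy.le⟩
    simpa [hx, hy] using this
  refine ⟨le_antisymm (upper hat htb ha hb) ?_,
    le_antisymm (upper (by linarith) (by linarith) ha' hb') ?_⟩
  · by_contra! h
    have hmem : a ∈ openSegment ℝ (a - 1) t := by
      rw [openSegment_eq_Ioo (by linarith)]; constructor <;> linarith
    have := hg.lt_left_of_right_lt (mem_univ _) (mem_univ _) hmem (by linarith)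
    linarith
  · by_contra! h
    have hmem : b - 1 ∈ openSegment ℝ (t - 1) b := by
      rw [openSegment_eq_Ioo (by linarith)]; constructor <;> linarith
    have := hg.lt_right_of_left_lt (mem_univ _) (mem_univ _) hmem (by linarith)
    linarith

/-- In the half-plane bounded by the line `ℝ d` and containing `v`, there is a point at distance
`1` from both `0` and `d`. -/
lemma exists_norm_eq_one_of_pair {d v : E} (hd : ‖d‖ = 1)
    (hind : ∀ a b : ℝ, a • v + b • d = 0 → a = 0 ∧ b = 0) :
    ∃ h t : ℝ, 0 ≤ h ∧ ‖h • v + t • d‖ = 1 ∧ ‖h • v + t • d - d‖ = 1 := by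
  set w : ℝ → E := fun s => (s * (1 - s)) • v + (1 - 2 * s) • d with hw
  have hwc : Continuous w := by fun_prop
  have hw0 : ∀ s, w s ≠ 0 := by
    intro s hs
    obtain ⟨h₁, h₂⟩ := hind _ _ hs
    nlinarith
  have hφ : ContinuousOn (fun s => ‖‖w s‖⁻¹ • w s - d‖) (Icc 0 1) := by
    refine Continuous.continuousOn ?_
    exact (((hwc.norm.inv₀ fun s => norm_ne_zero_iff.2 (hw0 s)).smul hwc).sub
      continuous_const).norm
  have h0 : ‖‖w 0‖⁻¹ • w 0 - d‖ = 0 := by simp [hw, hd]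
  have h1 : ‖‖w 1‖⁻¹ • w 1 - d‖ = 2 := by
    have e : ‖w 1‖⁻¹ • w 1 - d = (-2 : ℝ) • d := by
      have : w 1 = -d := by simp only [hw]; module
      rw [this, norm_neg, hd]; module
    rw [e, norm_smul, hd]; norm_num
  obtain ⟨s, ⟨hs0, hs1⟩, hs⟩ := intermediate_value_Icc zero_le_one hφ
    (show (1 : ℝ) ∈ Icc _ _ by rw [h0, h1]; norm_num)
  have e : (‖w s‖⁻¹ * (s * (1 - s))) • v + (‖w s‖⁻¹ * (1 - 2 * s)) • d = ‖w s‖⁻¹ • w s := by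
    simp only [hw]; module
  refine ⟨‖w s‖⁻¹ * (s * (1 - s)), ‖w s‖⁻¹ * (1 - 2 * s), ?_, ?_, ?_⟩
  · have : 0 ≤ 1 - s := by linarith
    positivity
  · rw [e, norm_smul, norm_inv, norm_norm, inv_mul_cancel₀ (norm_ne_zero_iff.2 (hw0 s))]
  · rw [e]; exact hs

lemma height_le_of_norm_eq_one {d v : E} (hd : ‖d‖ = 1) {h t h' t' : ℝ} (hh : 0 ≤ h)
    (h₁ : ‖h • v + t • d‖ = 1) (h₂ : ‖h • v + t • d - d‖ = 1)
    (h₁' : ‖h' • v + t' • d‖ = 1) (h₂' : ‖h' • v + t' • d - d‖ = 1) : h' ≤ h := by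
  by_contra! hlt
  set l := h / h' with hl
  have hh' : 0 < h' := hh.trans_lt hlt
  have hl0 : 0 ≤ l := by positivity
  have hl1 : l < 1 := (div_lt_one hh').2 hlt
  have hlh : l * h' = h := div_mul_cancel₀ _ hh'.ne'
  have key : ∀ y e : E, ‖y‖ = 1 → ‖e‖ = 1 → ‖l • y + ((1 - l) / 2) • e‖ < 1 := by
    intro y e hy he
    calc _ ≤ ‖l • y‖ + ‖((1 - l) / 2) • e‖ := norm_add_le _ _
      _ = l + (1 - l) / 2 := by
        rw [norm_smul, norm_smul, hy, he, Real.norm_of_nonneg hl0,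
          Real.norm_of_nonneg (by linarith), mul_one, mul_one]
      _ < 1 := by linarith
  have k₁ := key _ _ h₁' hd
  have k₂ := key _ (-d) h₂' (by rwa [norm_neg])
  set s := l * t' + (1 - l) / 2 with hs
  have e₁ : l • (h' • v + t' • d) + ((1 - l) / 2) • d = h • v + s • d := by
    rw [← hlh, hs]; module
  have e₂ : l • (h' • v + t' • d - d) + ((1 - l) / 2) • (-d) = h • v + (s - 1) • d := by
    rw [← hlh, hs]; module
  rw [e₁] at k₁
  rw [e₂] at k₂
  have e₃ : h • v + t • d - d = h • v + (t - 1) • d := by module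
  rw [e₃] at h₂
  exact absurd ((convexOn_norm_add_smul (h • v) d).one_le_of_eq_one h₂ h₁ k₂) (not_le.2 k₁)

/-- A unit equilateral triangle `0, d, p` extends to four points once there is a third
independent direction `q`. -/
lemma exists_norm_eq_one_of_triple {p q d : E} (hp : ‖p‖ = 1) (hd : ‖d‖ = 1) (hpd : ‖p - d‖ = 1)
    (hind : LinearIndependent ℝ ![q, p, d]) :
    ∃ y : E, ‖y‖ = 1 ∧ ‖y - d‖ = 1 ∧ ‖y - p‖ = 1 := by
  have hzero : ∀ a b c : ℝ, a • p + b • q + c • d = 0 → a = 0 ∧ b = 0 ∧ c = 0 := by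
    intro a b c h
    have := Fintype.linearIndependent_iff.1 hind ![b, a, c] (by
      simpa [Fin.sum_univ_three, add_comm (b • q)] using h)
    exact ⟨this 1, this 0, this 2⟩
  set v : ℝ → E := fun s => (1 - 2 * s) • p + (s * (1 - s)) • q with hv
  set P : ℝ × ℝ × ℝ → E := fun z => z.2.1 • v z.1 + z.2.2 • d with hP
  have hPc : Continuous P := by fun_prop
  obtain ⟨C, hC⟩ : ∃ C : ℝ, ∀ a b c : ℝ, ‖a • p + b • q + c • d‖ = 1 →
      |a| ≤ C ∧ |b| ≤ C ∧ |c| ≤ C := by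
    let L : ℝ × ℝ × ℝ →ₗ[ℝ] E :=
      (LinearMap.fst ℝ ℝ (ℝ × ℝ)).smulRight p +
        ((LinearMap.fst ℝ ℝ ℝ ∘ₗ LinearMap.snd ℝ ℝ (ℝ × ℝ)).smulRight q +
        (LinearMap.snd ℝ ℝ ℝ ∘ₗ LinearMap.snd ℝ ℝ (ℝ × ℝ)).smulRight d)
    have hL : ∀ a b c, L (a, b, c) = a • p + b • q + c • d := by
      intro a b c; simp [L, add_assoc]
    obtain ⟨K, -, hK⟩ := L.exists_antilipschitzWith (LinearMap.ker_eq_bot'.2 (by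
      rintro ⟨a, b, c⟩ h
      rw [hL] at h
      obtain ⟨rfl, rfl, rfl⟩ := hzero a b c h
      rfl))
    refine ⟨K, fun a b c h => ?_⟩
    have := hK.le_mul_dist (a, b, c) 0
    rw [map_zero, dist_zero_right, dist_zero_right, hL, h, mul_one] at this
    simpa [Prod.norm_def] using this
  set K : Set (ℝ × ℝ × ℝ) :=
    {z | z.1 ∈ Icc (0 : ℝ) 1 ∧ 0 ≤ z.2.1 ∧ ‖P z‖ = 1 ∧ ‖P z - d‖ = 1}
  have hKclosed : IsClosed K := by
    exact (isClosed_Icc.preimage continuous_fst).inter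
      ((isClosed_le continuous_const continuous_snd.fst).inter
      ((isClosed_eq hPc.norm continuous_const).inter
      (isClosed_eq (hPc.sub continuous_const).norm continuous_const)))
  have hKcompact : IsCompact K := by
    refine ((isCompact_Icc (a := (0 : ℝ)) (b := 1)).prod
      ((isCompact_Icc (a := (0 : ℝ)) (b := 5 * C)).prod
      (isCompact_Icc (a := -C) (b := C)))).of_isClosed_subset hKclosed ?_
    rintro ⟨s, h, t⟩ ⟨hs, hh, h₁, -⟩
    have e : P (s, h, t) = (h * (1 - 2 * s)) • p + (h * (s * (1 - s))) • q + t • d := by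
      simp only [hP, hv]; module
    rw [e] at h₁
    obtain ⟨ha, hb, hc⟩ := hC _ _ _ h₁
    simp only [mem_Icc] at hs hh
    refine ⟨hs, ⟨hh, ?_⟩, abs_le.1 hc⟩
    rw [abs_le] at ha hb
    show h ≤ 5 * C
    have : h * (1 - 2 * s) * (1 - 2 * s) ≤ C := by
      rcases le_total (1 - 2 * s) 0 with h' | h' <;> nlinarith
    nlinarith
  have hK₁ : IsCompact (K ∩ {z | ‖P z - p‖ ≤ 1}) :=
    hKcompact.inter_right (isClosed_le (by fun_prop) continuous_const)
  have hK₂ : IsCompact (K ∩ {z | 1 ≤ ‖P z - p‖}) :=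
    hKcompact.inter_right (isClosed_le continuous_const (by fun_prop))
  obtain ⟨s, -, ⟨⟨_, h, t⟩, ⟨⟨-, hh, h₁, h₂⟩, h₃⟩, rfl⟩,
      ⟨⟨s, h', t'⟩, ⟨⟨-, hh', h₁', h₂'⟩, h₃'⟩, rfl⟩⟩ :=
    isPreconnected_closed_iff.1 (isPreconnected_Icc (a := (0 : ℝ)) (b := 1)) _ _
      (hK₁.image continuous_fst).isClosed (hK₂.image continuous_fst).isClosed
      (by
        intro s hs
        obtain ⟨h, t, hh, h₁, h₂⟩ := exists_norm_eq_one_of_pair (v := v s) hd (by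
          intro a b hab
          have e : a • v s + b • d =
              (a * (1 - 2 * s)) • p + (a * (s * (1 - s))) • q + b • d := by
            simp only [hv]; module
          obtain ⟨h₁, h₂, h₃⟩ := hzero _ _ _ (e ▸ hab)
          exact ⟨by linear_combination (1 - 2 * s) * h₁ + 4 * h₂, h₃⟩)
        have hz : (s, h, t) ∈ K := ⟨hs, hh, h₁, h₂⟩
        rcases le_total ‖P (s, h, t) - p‖ 1 with h₃ | h₃
        · exact Or.inl ⟨_, ⟨hz, h₃⟩, rfl⟩
        · exact Or.inr ⟨_, ⟨hz, h₃⟩, rfl⟩)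
      ⟨0, by simp, ⟨0, 1, 0⟩, by
        have e : P (0, 1, 0) = p := by simp [hP, hv]
        refine ⟨⟨by simp, by simp, ?_, ?_⟩, ?_⟩ <;> simp [e, hp, hpd], rfl⟩
      ⟨1, by simp, ⟨1, 1, 1⟩, by
        have e : P (1, 1, 1) = d - p := by simp only [hP, hv]; module
        refine ⟨⟨by simp, by simp, ?_, ?_⟩, ?_⟩
        · rw [e, norm_sub_rev, hpd]
        · rw [e, sub_sub_cancel_left, norm_neg, hp]
        · show 1 ≤ ‖P (1, 1, 1) - p‖
          have e' : (2 : ℝ) • (d - p) = (d - p - p) + d := by module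
          have := norm_add_le (d - p - p) d
          rw [← e', norm_smul, norm_sub_rev, hpd, hd] at this
          rw [e]
          norm_num at this
          linarith, rfl⟩
  simp only [hP, mem_ofPred_eq] at h₁ h₂ h₃ h₁' h₂' h₃' hh hh'
  obtain rfl : h = h' := le_antisymm (height_le_of_norm_eq_one hd hh' h₁' h₂' h₁ h₂)
    (height_le_of_norm_eq_one hd hh h₁ h₂ h₁' h₂')
  obtain ⟨r, hr, hr'⟩ := intermediate_value_uIcc (a := t) (b := t')
    (f := fun r => ‖h • v s + r • d - p‖)
    (Continuous.continuousOn (by fun_prop)) (Icc_subset_uIcc ⟨h₃, h₃'⟩)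
  have e : ∀ r : ℝ, h • v s + (r - 1) • d = h • v s + r • d - d := fun r => by module
  have hmem := (convexOn_norm_add_smul (h • v s) d).ordConnected_eq_one.uIcc_subset
    ⟨h₁, by rw [e]; exact h₂⟩ ⟨h₁', by rw [e]; exact h₂'⟩ hr
  exact ⟨h • v s + r • d, hmem.1, by rw [← e]; exact hmem.2, hr'⟩

end ThirdPoint

section Extension

open Set

lemma MaximalEquilateral.not_forall_norm_sub_eq {E : Type*} [NormedAddCommGroup E] {A : Set E}
    (hA : MaximalEquilateral A) {lam : ℝ} (hlam : EquilateralWith A lam) (z : E) :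
    ¬ ∀ x ∈ A, ‖z - x‖ = lam := by
  intro hz
  have hins : Equilateral (insert z A) := by
    refine ⟨lam, hlam.1, hlam.2.insert fun x hx _ => ⟨hz x hx, ?_⟩⟩
    rw [norm_sub_rev]; exact hz x hx
  have hzA : z ∈ A := by
    rw [← hA.2 _ hins (subset_insert z A)]; exact mem_insert z A
  have := hz z hzA
  rw [sub_self, norm_zero] at this
  exact hlam.1.ne this

variable {E : Type*} [NormedAddCommGroup E] [NormedSpace ℝ E]

lemma exists_notMem_span_pair (hE : 3 ≤ Module.rank ℝ E) (x y : E) :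
    ∃ z, z ∉ Submodule.span ℝ {x, y} := by
  by_contra! h
  have htop : Submodule.span ℝ {x, y} = ⊤ := Submodule.eq_top_iff'.2 h
  have h₁ := rank_span_le (R := ℝ) ({x, y} : Set E)
  rw [htop, rank_top] at h₁
  have h₂ : Cardinal.mk ({x, y} : Set E) ≤ 2 := Cardinal.mk_insert_le.trans (by
    rw [Cardinal.mk_singleton, one_add_one_eq_two])
  have h₃ : (3 : Cardinal) ≤ 2 := hE.trans (h₁.trans h₂)
  exact absurd h₃ (by norm_num)

lemma norm_inv_smul_of_norm_eq {lam : ℝ} (hlam : 0 < lam) {x : E} (hx : ‖x‖ = lam) :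
    ‖lam⁻¹ • x‖ = 1 := by
  rw [norm_smul, hx, norm_inv, Real.norm_of_nonneg hlam.le, inv_mul_cancel₀ hlam.ne']

lemma norm_add_smul_sub_of_norm_eq_one {lam : ℝ} (hlam : 0 < lam) {a x y : E}
    (h : ‖y - lam⁻¹ • (x - a)‖ = 1) : ‖a + lam • y - x‖ = lam := by
  have e : a + lam • y - x = lam • (y - lam⁻¹ • (x - a)) := by
    rw [smul_sub, smul_inv_smul₀ hlam.ne']; abel
  rw [e, norm_smul, h, mul_one, Real.norm_of_nonneg hlam.le]

/-- In dimension at least `3`, for three points at mutual distance `lam` there is a point at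
distance `lam` from all of them. -/
lemma exists_norm_sub_eq_of_triple (hE : 3 ≤ Module.rank ℝ E) {a b c : E} {lam : ℝ} (hlam : 0 < lam)
    (hab : ‖b - a‖ = lam) (hac : ‖c - a‖ = lam) (hbc : ‖c - b‖ = lam) :
    ∃ z : E, ‖z - a‖ = lam ∧ ‖z - b‖ = lam ∧ ‖z - c‖ = lam := by
  have hd := norm_inv_smul_of_norm_eq hlam hab
  have hp := norm_inv_smul_of_norm_eq hlam hac
  have hpd : ‖lam⁻¹ • (c - a) - lam⁻¹ • (b - a)‖ = 1 := by
    rw [← smul_sub, sub_sub_sub_cancel_right]; exact norm_inv_smul_of_norm_eq hlam hbc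
  set d := lam⁻¹ • (b - a)
  set p := lam⁻¹ • (c - a)
  obtain ⟨q, hq⟩ := exists_notMem_span_pair hE p d
  have hd0 : d ≠ 0 := by rintro h; simp [h] at hd
  have hpspan : p ∉ Submodule.span ℝ {d} := by
    rw [Submodule.mem_span_singleton]
    rintro ⟨r, hr⟩
    have e : r • d - d = (r - 1) • d := by module
    rw [← hr, norm_smul, hd, mul_one, Real.norm_eq_abs] at hp
    rw [← hr, e, norm_smul, hd, mul_one, Real.norm_eq_abs] at hpd
    rcases abs_cases r with h | h <;> rcases abs_cases (r - 1) with h' | h' <;> linarith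
  have hpd2 : LinearIndependent ℝ ![p, d] :=
    linearIndependent_finCons.2 ⟨by simpa using hd0, by simpa using hpspan⟩
  have hqpd : LinearIndependent ℝ ![q, p, d] :=
    linearIndependent_finCons.2 ⟨hpd2, by simpa [pair_comm] using hq⟩
  obtain ⟨y, h₁, h₂, h₃⟩ := exists_norm_eq_one_of_triple hp hd hpd hqpd
  exact ⟨a + lam • y, norm_add_smul_sub_of_norm_eq_one hlam (by simpa using h₁),
    norm_add_smul_sub_of_norm_eq_one hlam h₂, norm_add_smul_sub_of_norm_eq_one hlam h₃⟩

lemma exists_norm_sub_eq_of_pair (hE : 3 ≤ Module.rank ℝ E) {a b : E} {lam : ℝ} (hlam : 0 < lam)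
    (hab : ‖b - a‖ = lam) : ∃ z : E, ‖z - a‖ = lam ∧ ‖z - b‖ = lam := by
  have hd : ‖lam⁻¹ • (b - a)‖ = 1 := norm_inv_smul_of_norm_eq hlam hab
  set d := lam⁻¹ • (b - a)
  have hd0 : d ≠ 0 := by rintro h; simp [h] at hd
  obtain ⟨v, hv⟩ := exists_notMem_span_pair hE d d
  have hind : LinearIndependent ℝ ![v, d] :=
    linearIndependent_finCons.2 ⟨by simpa using hd0, by simpa using hv⟩
  obtain ⟨h, t, -, h₁, h₂⟩ := exists_norm_eq_one_of_pair hd (LinearIndependent.pair_iff.1 hind)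
  set y := h • v + t • d
  exact ⟨a + lam • y, norm_add_smul_sub_of_norm_eq_one hlam (by simpa using h₁),
    norm_add_smul_sub_of_norm_eq_one hlam h₂⟩

lemma MaximalEquilateral.four_le_ncard (hE : 3 ≤ Module.rank ℝ E) {A : Set E}
    (hA : MaximalEquilateral A) (hfin : A.Finite) : 4 ≤ A.ncard := by
  obtain ⟨lam, hlam⟩ := hA.1
  by_contra! hlt
  have hcases : A.ncard = 0 ∨ A.ncard = 1 ∨ A.ncard = 2 ∨ A.ncard = 3 := by omega
  rcases hcases with h | h | h | h
  · rw [ncard_eq_zero hfin] at h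
    subst h
    exact hA.not_forall_norm_sub_eq hlam 0 (by simp)
  · obtain ⟨a, rfl⟩ := ncard_eq_one.1 h
    obtain ⟨v, hv⟩ := exists_notMem_span_pair hE 0 0
    have hv0 : v ≠ 0 := by rintro rfl; exact hv (zero_mem _)
    refine hA.not_forall_norm_sub_eq hlam (a + (lam * ‖v‖⁻¹) • v) ?_
    rintro x rfl
    rw [add_sub_cancel_left, norm_smul, norm_mul, norm_inv, norm_norm,
      inv_mul_cancel_right₀ (norm_ne_zero_iff.2 hv0), Real.norm_of_nonneg hlam.1.le]
  · obtain ⟨a, b, hab, rfl⟩ := ncard_eq_two.1 h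
    obtain ⟨z, h₁, h₂⟩ := exists_norm_sub_eq_of_pair hE hlam.1
      (hlam.2 (by simp : b ∈ _) (by simp : a ∈ _) hab.symm)
    exact hA.not_forall_norm_sub_eq hlam z (by simp [h₁, h₂])
  · obtain ⟨a, b, c, hab, hac, hbc, rfl⟩ := ncard_eq_three.1 h
    obtain ⟨z, h₁, h₂, h₃⟩ := exists_norm_sub_eq_of_triple hE hlam.1
      (hlam.2 (by simp : b ∈ _) (by simp : a ∈ _) hab.symm)
      (hlam.2 (by simp : c ∈ _) (by simp : a ∈ _) hac.symm)
      (hlam.2 (by simp : c ∈ _) (by simp : b ∈ _) hbc.symm)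
    exact hA.not_forall_norm_sub_eq hlam z (by simp [h₁, h₂, h₃])

end Extension

section SmoothPoint

open Set

variable {X : Type*} [NormedAddCommGroup X] [NormedSpace ℝ X]

lemma exists_functional_of_norm_add_eq_two {x y : X} (hx : ‖x‖ = 1) (hy : ‖y‖ = 1)
    (hxy : ‖x + y‖ = 2) : ∃ f : X →L[ℝ] ℝ, ‖f‖ = 1 ∧ f x = 1 ∧ f y = 1 := by
  obtain ⟨f, hf, hfxy⟩ := exists_dual_vector ℝ (x + y) (by
    intro h
    rw [h] at hxy
    simp at hxy)
  have hle : ∀ z : X, ‖z‖ = 1 → f z ≤ 1 := fun z hz => by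
    have := (le_abs_self _).trans (f.le_opNorm z)
    rwa [hf, hz, mul_one] at this
  have h₁ := hle x hx
  have h₂ := hle y hy
  rw [map_add, hxy] at hfxy
  norm_num at hfxy
  exact ⟨f, hf, by linarith, by linarith⟩

lemma norm_sub_ne_two_of_norm_add_eq_two {u : X} (hu : ‖u‖ = 1)
    (hsmooth : ∃! f : X →L[ℝ] ℝ, ‖f‖ = 1 ∧ f u = 1) {x : X} (hx : ‖x‖ = 1)
    (h₁ : ‖u + x‖ = 2) : ‖u - x‖ ≠ 2 := by
  intro h₂
  obtain ⟨f, hf, hfu, hfx⟩ := exists_functional_of_norm_add_eq_two hu hx h₁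
  obtain ⟨g, hg, hgu, hgx⟩ := exists_functional_of_norm_add_eq_two hu
    (y := -x) (by rwa [norm_neg]) (by rwa [← sub_eq_add_neg])
  rw [hsmooth.unique ⟨hf, hfu⟩ ⟨hg, hgu⟩] at hfx
  rw [map_neg] at hgx
  linarith

lemma WithLp.norm_toLp_sub_toLp_one {X : Type*} [NormedAddCommGroup X] (x y : X) (r s : ℝ) :
    ‖WithLp.toLp 1 (x, r) - WithLp.toLp 1 (y, s)‖ = ‖x - y‖ + |r - s| := by
  rw [WithLp.prod_norm_eq_of_L1]
  rfl

lemma exists_maximalEquilateral_ncard_eq_four {u : X} (hu : ‖u‖ = 1)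
    (hsmooth : ∃! f : X →L[ℝ] ℝ, ‖f‖ = 1 ∧ f u = 1) :
    ∃ A : Set (WithLp 1 (X × ℝ)), MaximalEquilateral A ∧ A.Finite ∧ A.ncard = 4 := by
  have huu : ‖u + u‖ = 2 := by rw [← two_smul ℝ, norm_smul, hu]; norm_num
  set a : WithLp 1 (X × ℝ) := WithLp.toLp 1 (u, 0) with ha
  set b : WithLp 1 (X × ℝ) := WithLp.toLp 1 (-u, 0) with hb
  set c : WithLp 1 (X × ℝ) := WithLp.toLp 1 (0, 1) with hc
  set d : WithLp 1 (X × ℝ) := WithLp.toLp 1 (0, -1) with hd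
  have hab : ‖a - b‖ = 2 := by simp [ha, hb, WithLp.norm_toLp_sub_toLp_one, huu]
  have hac : ‖a - c‖ = 2 := by
    simp [ha, hc, WithLp.norm_toLp_sub_toLp_one, hu]; norm_num
  have had : ‖a - d‖ = 2 := by
    simp [ha, hd, WithLp.norm_toLp_sub_toLp_one, hu]; norm_num
  have hbc : ‖b - c‖ = 2 := by
    simp [hb, hc, WithLp.norm_toLp_sub_toLp_one, hu]; norm_num
  have hbd : ‖b - d‖ = 2 := by
    simp [hb, hd, WithLp.norm_toLp_sub_toLp_one, hu]; norm_num
  have hcd : ‖c - d‖ = 2 := by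
    simp [hc, hd, WithLp.norm_toLp_sub_toLp_one]; norm_num
  have hne : ∀ {x y : WithLp 1 (X × ℝ)}, ‖x - y‖ = 2 → x ≠ y := by
    rintro x y h rfl
    rw [sub_self, norm_zero] at h
    norm_num at h
  refine ⟨{a, b, c, d}, ⟨⟨2, two_pos, ?_⟩, ?_⟩, toFinite _, ?_⟩
  · intro x hx y hy hxy
    simp only [mem_insert_iff, mem_singleton_iff] at hx hy
    rcases hx with rfl | rfl | rfl | rfl <;> rcases hy with rfl | rfl | rfl | rfl <;>
      first
        | exact absurd rfl hxy
        | assumption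
        | (rw [norm_sub_rev]; assumption)
  · rintro B ⟨lam, -, hB⟩ hAB
    have haB : a ∈ B := hAB (by simp)
    have hbB : b ∈ B := hAB (by simp)
    have hcB : c ∈ B := hAB (by simp)
    have hdB : d ∈ B := hAB (by simp)
    obtain rfl : 2 = lam := hab.symm.trans (hB haB hbB (hne hab))
    refine (hAB.antisymm fun z hz => ?_).symm
    by_contra hzA
    simp only [mem_insert_iff, mem_singleton_iff, not_or] at hzA
    obtain ⟨hza, hzb, hzc, hzd⟩ := hzA
    have h₁ := hB hz haB hza
    have h₂ := hB hz hbB hzb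
    have h₃ := hB hz hcB hzc
    have h₄ := hB hz hdB hzd
    obtain ⟨x, r⟩ := z
    simp only [ha, hb, hc, hd, WithLp.norm_toLp_sub_toLp_one, sub_zero, sub_neg_eq_add]
      at h₁ h₂ h₃ h₄
    obtain rfl : r = 0 := by
      rcases abs_cases (r - 1) with h | h <;> rcases abs_cases (r + 1) with h' | h' <;> linarith
    norm_num at h₁ h₂ h₃
    exact norm_sub_ne_two_of_norm_add_eq_two hu hsmooth (x := x) (by linarith)
      (by rwa [add_comm]) (by rwa [norm_sub_rev])
  · rw [ncard_insert_of_notMem (by simp [hne hab, hne hac, hne had]),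
      ncard_insert_of_notMem (by simp [hne hbc, hne hbd]), ncard_pair (hne hcd)]

end SmoothPoint

/-- Let `X` be a normed space of dimension at least `2` whose unit sphere
has a smooth point, i.e. a unit vector `u` admitting exactly one continuous linear
functional `f` with `‖f‖ = 1` and `f u = 1`. Then `m(X ⊕₁ ℝ) = 4`: the `ℓ₁`-sum
`X ⊕₁ ℝ` has a maximal equilateral set with `4` elements, and every maximal equilateral
set in it has at least `4` elements. -/
theorem statement9 (X : Type*) [NormedAddCommGroup X] [NormedSpace ℝ X]
    (hdim : 2 ≤ Module.rank ℝ X)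
    (u : X) (hu : ‖u‖ = 1)
    (hsmooth : ∃! f : X →L[ℝ] ℝ, ‖f‖ = 1 ∧ f u = 1) :
    (∃ A : Set (WithLp 1 (X × ℝ)), MaximalEquilateral A ∧ A.Finite ∧ A.ncard = 4) ∧
    ∀ A : Set (WithLp 1 (X × ℝ)), MaximalEquilateral A → A.Finite → 4 ≤ A.ncard := by
  have hrank : 3 ≤ Module.rank ℝ (WithLp 1 (X × ℝ)) := by
    rw [(WithLp.linearEquiv 1 ℝ (X × ℝ)).rank_eq, rank_prod, Module.rank_self, Cardinal.lift_one,
      Cardinal.lift_id'.{0}]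
    calc (3 : Cardinal) = 2 + 1 := by norm_num
      _ ≤ _ := by gcongr
  exact ⟨exists_maximalEquilateral_ncard_eq_four hu hsmooth,
    fun A hA hfin => hA.four_le_ncard hrank hfin⟩
end

section
/- Let X be a strictly convex 2-dimensional normed space and let u, v ∈ X be linearly independent unit vectors. If x ∈ X satisfies ‖x − u‖ = ‖x + u‖ and ‖x − v‖ = ‖x + v‖, then x = 0. -/
section IsoscelesOrthogonality

variable {X : Type*} [NormedAddCommGroup X] [NormedSpace ℝ X]

/-- Strict form of the monotonicity lemma for norms, when `v` is beyond the segment joining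
`u` to `-(a • u - b • v)`. -/
lemma norm_sub_add_right_lt_of_le [StrictConvexSpace ℝ X] {u v : X} (hu : ‖u‖ = 1)
    (hv : ‖v‖ = 1) (huv : ∀ s t : ℝ, s • u + t • v = 0 → s = 0 ∧ t = 0) {a b : ℝ}
    (ha : 0 < a) (hb : 0 < b) (hab : b ≤ 1 + a) :
    ‖a • u - b • v + v‖ < ‖a • u - b • v + u‖ := by
  have hray : ¬ SameRay ℝ (a • u - b • v + u) (b • v) := by
    intro h
    have hbv : b • v ≠ 0 := by
      rw [← norm_ne_zero_iff, norm_smul, hv, Real.norm_of_nonneg hb.le]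
      linarith
    obtain ⟨r, -, hr⟩ := h.exists_nonneg_right hbv
    have h0 := huv (a + 1) (-b - r * b) (by
      have h1 : (a + 1) • u + (-b - r * b) • v = (a • u - b • v + u) - r • b • v := by module
      rw [h1, hr, sub_self])
    linarith [h0.1]
  have h1 := norm_add_lt_of_not_sameRay hray
  have e1 : a • u - b • v + u + b • v = (1 + a) • u := by module
  rw [e1, norm_smul, norm_smul, hu, hv, Real.norm_of_nonneg hb.le,
    Real.norm_of_nonneg (by linarith)] at h1
  have h2 := norm_add_le (a • (a • u - b • v + u)) ((1 + a - b) • v)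
  have e2 : a • (a • u - b • v + u) + (1 + a - b) • v = (1 + a) • (a • u - b • v + v) := by
    module
  rw [e2, norm_smul, norm_smul, norm_smul, hv, Real.norm_of_nonneg ha.le,
    Real.norm_of_nonneg (by linarith : 0 ≤ 1 + a),
    Real.norm_of_nonneg (by linarith : 0 ≤ 1 + a - b)] at h2
  refine lt_of_mul_lt_mul_left (a := 1 + a) ?_ (by linarith)
  linarith

/-- The monotonicity lemma for norms, when `v` lies inside the triangle with vertices
`0`, `u` and `-(a • u - b • v)`. -/
lemma norm_sub_add_right_le_of_lt {u v : X} (hu : ‖u‖ = 1) (hv : ‖v‖ = 1) {a b : ℝ}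
    (ha : 0 < a) (hab : 1 + a < b) :
    ‖a • u - b • v + v‖ ≤ ‖a • u - b • v + u‖ := by
  have h1 := norm_sub_le ((b - 1) • (a • u - b • v + u)) ((b - 1 - a) • u)
  have e1 : (b - 1) • (a • u - b • v + u) - (b - 1 - a) • u = b • (a • u - b • v + v) := by
    module
  rw [e1, norm_smul, norm_smul, norm_smul, hu,
    Real.norm_of_nonneg (by linarith : 0 ≤ b),
    Real.norm_of_nonneg (by linarith : 0 ≤ b - 1),
    Real.norm_of_nonneg (by linarith : 0 ≤ b - 1 - a)] at h1
  have h2 := norm_sub_le (a • u) (a • u - b • v + v)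
  have e2 : a • u - (a • u - b • v + v) = (b - 1) • v := by module
  rw [e2, norm_smul, norm_smul, hu, hv, Real.norm_of_nonneg ha.le,
    Real.norm_of_nonneg (by linarith : 0 ≤ b - 1)] at h2
  refine le_of_mul_le_mul_left (a := b - 1) ?_ (by linarith)
  linarith

lemma norm_sub_add_right_le [StrictConvexSpace ℝ X] {u v : X} (hu : ‖u‖ = 1)
    (hv : ‖v‖ = 1) (huv : ∀ s t : ℝ, s • u + t • v = 0 → s = 0 ∧ t = 0) {a b : ℝ}
    (ha : 0 < a) (hb : 0 < b) :
    ‖a • u - b • v + v‖ ≤ ‖a • u - b • v + u‖ := by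
  rcases le_or_gt b (1 + a) with h | h
  · exact (norm_sub_add_right_lt_of_le hu hv huv ha hb h).le
  · exact norm_sub_add_right_le_of_lt hu hv ha h

/-- A vector `a • u - b • v` with `0 < b ≤ a` is not isosceles orthogonal to both `u` and `v`. -/
lemma not_isosceles_of_le [StrictConvexSpace ℝ X] {u v : X} (hu : ‖u‖ = 1)
    (hv : ‖v‖ = 1) (huv : ∀ s t : ℝ, s • u + t • v = 0 → s = 0 ∧ t = 0) {a b : ℝ}
    (hb : 0 < b) (hab : b ≤ a)
    (hxu : ‖a • u - b • v - u‖ = ‖a • u - b • v + u‖)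
    (hxv : ‖a • u - b • v - v‖ = ‖a • u - b • v + v‖) : False := by
  have h1 := norm_sub_add_right_lt_of_le hu hv huv (hb.trans_le hab) hb (by linarith)
  have h2 := norm_sub_add_right_le hv hu
    (fun s t h ↦ (huv t s (by rwa [add_comm])).symm) hb (hb.trans_le hab)
  have e1 : b • v - a • u + u = -(a • u - b • v - u) := by module
  have e2 : b • v - a • u + v = -(a • u - b • v - v) := by module
  rw [e1, e2, norm_neg, norm_neg] at h2
  linarith

lemma not_isosceles_of_pos [StrictConvexSpace ℝ X] {u v : X} (hu : ‖u‖ = 1)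
    (hv : ‖v‖ = 1) (huv : ∀ s t : ℝ, s • u + t • v = 0 → s = 0 ∧ t = 0) {a b : ℝ}
    (ha : 0 < a) (hb : 0 < b)
    (hxu : ‖a • u - b • v - u‖ = ‖a • u - b • v + u‖)
    (hxv : ‖a • u - b • v - v‖ = ‖a • u - b • v + v‖) : False := by
  rcases le_total b a with h | h
  · exact not_isosceles_of_le hu hv huv hb h hxu hxv
  · have e (w : X) : b • v - a • u - w = -(a • u - b • v + w) := by module
    have e' (w : X) : b • v - a • u + w = -(a • u - b • v - w) := by module
    refine not_isosceles_of_le hv hu (fun s t h ↦ (huv t s (by rwa [add_comm])).symm) ha h ?_ ?_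
    · rw [e, e', norm_neg, norm_neg, hxv]
    · rw [e, e', norm_neg, norm_neg, hxu]

/-- A multiple of a unit vector is isosceles orthogonal to it only if it vanishes. -/
lemma eq_zero_of_isosceles_smul {u : X} (hu : ‖u‖ = 1) {a : ℝ}
    (h : ‖a • u - u‖ = ‖a • u + u‖) : a = 0 := by
  have e1 : a • u - u = (a - 1) • u := by module
  have e2 : a • u + u = (a + 1) • u := by module
  rw [e1, e2, norm_smul, norm_smul, hu, mul_one, mul_one, Real.norm_eq_abs, Real.norm_eq_abs,
    abs_eq_abs] at h
  rcases h with h | h <;> linarith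

end IsoscelesOrthogonality

/-- Let `X` be a strictly convex 2-dimensional normed space and let
`u, v ∈ X` be linearly independent unit vectors. If `x ∈ X` satisfies
`‖x − u‖ = ‖x + u‖` and `‖x − v‖ = ‖x + v‖`, then `x = 0`. -/
theorem statement13 (X : Type*) [NormedAddCommGroup X] [NormedSpace ℝ X]
    [StrictConvexSpace ℝ X] (hdim : Module.finrank ℝ X = 2)
    (u v : X) (hu : ‖u‖ = 1) (hv : ‖v‖ = 1) (huv : LinearIndependent ℝ ![u, v])
    (x : X) (hxu : ‖x - u‖ = ‖x + u‖) (hxv : ‖x - v‖ = ‖x + v‖) :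
    x = 0 := by
  have := Module.finite_of_finrank_pos (R := ℝ) (M := X) (by omega)
  have hspan := huv.span_eq_top_of_card_eq_finrank' (by simp [hdim])
  have hx : x ∈ Submodule.span ℝ {u, v} := by
    have : Set.range ![u, v] = {u, v} := by simp [Set.pair_comm]
    rw [← this, hspan]
    trivial
  obtain ⟨a, b, rfl⟩ := Submodule.mem_span_pair.1 hx
  rw [LinearIndependent.pair_iff] at huv
  have key : ∀ ε δ : ℝ, (ε = 1 ∨ ε = -1) → (δ = 1 ∨ δ = -1) → 0 < ε * a → 0 < δ * b → False := by
    intro ε δ hε hδ ha hb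
    have e : (ε * a) • ε • u - (δ * b) • (-δ) • v = a • u + b • v := by
      rcases hε with rfl | rfl <;> rcases hδ with rfl | rfl <;> module
    refine not_isosceles_of_pos (u := ε • u) (v := (-δ) • v) ?_ ?_ ?_ ha hb ?_ ?_
    · rcases hε with rfl | rfl <;> simp [hu]
    · rcases hδ with rfl | rfl <;> simp [hv]
    · intro s t h
      have h0 := huv (s * ε) (t * -δ) (by rw [mul_smul, mul_smul, h])
      rcases hε with rfl | rfl <;> rcases hδ with rfl | rfl <;> simpa using h0
    · rw [e]
      rcases hε with rfl | rfl <;> simp [← sub_eq_add_neg, hxu]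
    · rw [e]
      rcases hδ with rfl | rfl <;> simp [← sub_eq_add_neg, hxv]
  rcases lt_trichotomy a 0 with ha | rfl | ha
  · rcases lt_trichotomy b 0 with hb | rfl | hb
    · exact (key (-1) (-1) (by simp) (by simp) (by linarith) (by linarith)).elim
    · have := eq_zero_of_isosceles_smul hu (by simpa using hxu)
      linarith
    · exact (key (-1) 1 (by simp) (by simp) (by linarith) (by linarith)).elim
  · have := eq_zero_of_isosceles_smul hv (by simpa using hxv)
    simp [this]
  · rcases lt_trichotomy b 0 with hb | rfl | hb
    · exact (key 1 (-1) (by simp) (by simp) (by linarith) (by linarith)).elim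
    · have := eq_zero_of_isosceles_smul hu (by simpa using hxu)
      linarith
    · exact (key 1 1 (by simp) (by simp) (by linarith) (by linarith)).elim
end
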